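/- arXiv:1210.4215 — 2 statements merged into one kernel-verified Lean document; each statement's English description precedes it below -/
import Mathlib

section
/- There exist constants c̃_A ≥ 1 and C, depending only on ξ, A, B, such that for all sufficiently large N (depending only on A) the following holds. Let f satisfy condition (f), let M ≥ 0, write w_n = s_{M+n} for 1 ≤ n ≤ N, and let g be the N^{38}-th partial sum of the Fourier series of f. Then for any τ > 0 satisfying τ ≥ N^{-1/2} and 12 τ ⌈N^{1/8}⌉ ≤ 1 one has ∫_A^B exp( τ Σ_{n=1}^{N} g(ξ x^{w_n}) ) dx ≤ C · exp( τ² c̃_A ‖f‖ N ). -/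
open MeasureTheory Filter

/-- The `L²` norm of `f` over `[A,B]`. -/
noncomputable def fnorm (A B : ℝ) (f : ℝ → ℝ) : ℝ :=
  Real.sqrt (∫ x in A..B, (f x) ^ 2)

/-- Fourier cosine coefficient of a 1-periodic function. -/
noncomputable def fourierA (f : ℝ → ℝ) (j : ℕ) : ℝ :=
  2 * ∫ x in (0:ℝ)..1, f x * Real.cos (2 * Real.pi * j * x)

/-- Fourier sine coefficient of a 1-periodic function. -/
noncomputable def fourierB (f : ℝ → ℝ) (j : ℕ) : ℝ :=
  2 * ∫ x in (0:ℝ)..1, f x * Real.sin (2 * Real.pi * j * x)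

/-- The `d`-th partial sum of the Fourier series of `f`. -/
noncomputable def fourierPartial (f : ℝ → ℝ) (d : ℕ) (x : ℝ) : ℝ :=
  ∑ j ∈ Finset.Icc 1 d,
    (fourierA f j * Real.cos (2 * Real.pi * j * x) +
     fourierB f j * Real.sin (2 * Real.pi * j * x))

noncomputable def mm (t : ℝ) : ℝ := (2 * t + t ^ 3) / (1 + t ^ 2) ^ 2
noncomputable def ww (t : ℝ) : ℝ := 1 / (1 + t ^ 2) ^ 2

lemma ww_add (t : ℝ) : ww t + t * mm t = 1 := by
  unfold ww mm
  have : (1 + t ^ 2) ≠ 0 := by positivity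
  field_simp
  ring

lemma ww_nonneg (t : ℝ) : 0 ≤ ww t := by unfold ww; positivity

lemma abs_mm_le (t : ℝ) : |mm t| ≤ 1 := by
  unfold mm
  rw [abs_div, abs_of_pos (by positivity : (0:ℝ) < (1 + t ^ 2) ^ 2), div_le_one (by positivity), abs_le]
  constructor <;> nlinarith [sq_nonneg (t - 1), sq_nonneg (t + 1), mul_nonneg (sq_nonneg t) (sq_nonneg (t-1)), mul_nonneg (sq_nonneg t) (sq_nonneg (t+1))]

noncomputable def mmd (t : ℝ) : ℝ := (2 - 3 * t ^ 2 - t ^ 4) / (1 + t ^ 2) ^ 3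

lemma hasDerivAt_mm (t : ℝ) : HasDerivAt mm (mmd t) t := by
  have h0 : (1 + t ^ 2) ≠ 0 := by positivity
  have h1 : HasDerivAt (fun t : ℝ => 2 * t + t ^ 3) (2 * 1 + 3 * t ^ 2) t := by
    exact (((hasDerivAt_id t).const_mul 2).add (hasDerivAt_pow 3 t)).congr_deriv (by norm_num)
  have h2 : HasDerivAt (fun t : ℝ => (1 + t ^ 2) ^ 2) (2 * (1 + t ^ 2) * (2 * t)) t := by
    exact (((hasDerivAt_pow 2 t).const_add 1).pow 2).congr_deriv (by norm_num)
  have h3 := h1.div h2 (by positivity)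
  refine h3.congr_deriv ?_
  unfold mmd
  field_simp
  ring

lemma abs_mmd_le (t : ℝ) : |mmd t| ≤ 2 * (1 / (1 + t ^ 2)) := by
  unfold mmd
  rw [abs_div, abs_of_pos (by positivity : (0:ℝ) < (1 + t ^ 2) ^ 3), div_le_iff₀ (by positivity)]
  have h0 : (1 + t ^ 2) ≠ 0 := by positivity
  have : 2 * (1 / (1 + t ^ 2)) * (1 + t ^ 2) ^ 3 = 2 * (1 + t^2)^2 := by
    field_simp
  rw [this, abs_le]
  constructor <;> nlinarith [sq_nonneg t, sq_nonneg (t^2)]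

lemma continuous_mm : Continuous mm := continuous_iff_continuousAt.2 fun t => (hasDerivAt_mm t).continuousAt
lemma continuous_mmd : Continuous mmd := by
  unfold mmd
  apply Continuous.div (by fun_prop) (by fun_prop)
  intro x; positivity
lemma continuous_ww : Continuous ww := by
  unfold ww
  apply Continuous.div (by fun_prop) (by fun_prop)
  intro x; positivity

/-- the ratio function -/
noncomputable def qq (n e : ℕ) (x : ℝ) : ℝ := ((n + 1 + e : ℝ) / (n + 1)) * x ^ e

noncomputable def pp (ξ : ℝ) (n : ℕ) (x : ℝ) : ℝ := 1 / (ξ * (n + 1) * x ^ n)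

lemma continuous_qq (n e : ℕ) : Continuous (qq n e) := by unfold qq; fun_prop

lemma pp_pos {ξ x : ℝ} (n : ℕ) (hξ : 0 < ξ) (hx : 0 < x) : 0 < pp ξ n x := by
  unfold pp; positivity

lemma osc_main (ξ a b : ℝ) (n e : ℕ) (j k θ : ℝ) (hξ : 0 < ξ) (ha : 0 < a) (hab : a ≤ b) :
    |∫ x in a..b, Real.cos (2 * Real.pi * (ξ * (j * x ^ (n+1) + k * x ^ (n+1+e))) + θ) *
      ((j + k * qq n e x) * mm (j + k * qq n e x))| ≤ 2 * pp ξ n a := by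
  set Φ : ℝ → ℝ := fun x => 2 * Real.pi * (ξ * (j * x ^ (n+1) + k * x ^ (n+1+e))) + θ with hΦ
  set ψ : ℝ → ℝ := fun x => j + k * qq n e x with hψ
  set q' : ℝ → ℝ := fun x => ((n + 1 + e : ℝ) / (n + 1)) * (e * x ^ (e - 1)) with hq'
  set p' : ℝ → ℝ := fun x => - (ξ * (n+1) * (n * x ^ (n-1))) / (ξ * (n + 1) * x ^ n) ^ 2 with hp'
  have hpos : ∀ x ∈ Set.uIcc a b, 0 < x := by
    intro x hx
    rw [Set.uIcc_of_le hab] at hx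
    exact lt_of_lt_of_le ha hx.1
  have hn : (0:ℝ) < n + 1 := by positivity
  have dψ : ∀ x, HasDerivAt ψ (k * q' x) x := by
    intro x
    have := (((hasDerivAt_pow e x).const_mul ((n + 1 + e : ℝ) / (n + 1))).const_mul k).const_add j
    exact this
  have dp : ∀ x, 0 < x → HasDerivAt (pp ξ n) (p' x) x := by
    intro x hx
    have h1 := (hasDerivAt_pow n x).const_mul (ξ * (n+1))
    have h2 := h1.inv (by positivity)
    have : pp ξ n = (fun x => ξ * (n+1) * x ^ n)⁻¹ := by
      funext y; simp [pp]
    rw [this]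
    exact h2
  have dΦ : ∀ x, 0 < x → HasDerivAt Φ (2 * Real.pi * ((pp ξ n x)⁻¹ * ψ x)) x := by
    intro x hx
    have h1 := (((hasDerivAt_pow (n+1) x).const_mul j).add ((hasDerivAt_pow (n+1+e) x).const_mul k))
    have h2 := ((h1.const_mul ξ).const_mul (2 * Real.pi)).add_const θ
    refine h2.congr_deriv ?_
    simp only [pp, hψ, qq]
    have e1 : n + 1 + e - 1 = n + e := by omega
    have e2 : n + 1 - 1 = n := by omega
    rw [e1, e2]
    push_cast
    field_simp
    ring
  have dF : ∀ x, 0 < x → HasDerivAt (fun x => Real.sin (Φ x) * (pp ξ n x * mm (ψ x)))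
      (2 * Real.pi * (Real.cos (Φ x) * (ψ x * mm (ψ x))) +
        Real.sin (Φ x) * (p' x * mm (ψ x) + pp ξ n x * (mmd (ψ x) * (k * q' x)))) x := by
    intro x hx
    have h1 := (dΦ x hx).sin
    have h2 : HasDerivAt (fun x => mm (ψ x)) (mmd (ψ x) * (k * q' x)) x :=
      HasDerivAt.comp x (hasDerivAt_mm (ψ x)) (dψ x)
    have h3 := h1.mul ((dp x hx).mul h2)
    refine h3.congr_deriv ?_
    have := (pp_pos n hξ hx).ne'
    simp only [Pi.mul_apply]
    field_simp
  have cΦ : Continuous Φ := by fun_prop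
  have cψ : Continuous ψ := by have := continuous_qq n e; fun_prop
  have cq : Continuous q' := by fun_prop
  have cp : ContinuousOn (pp ξ n) (Set.uIcc a b) := fun x hx => (dp x (hpos x hx)).continuousAt.continuousWithinAt
  have cp' : ContinuousOn p' (Set.uIcc a b) := by
    apply ContinuousOn.div (by fun_prop) (by fun_prop)
    intro x hx
    have := hpos x hx
    positivity
  have cm : Continuous (fun x => mm (ψ x)) := continuous_mm.comp cψ
  have cmd : Continuous (fun x => mmd (ψ x)) := continuous_mmd.comp cψ
  have i1 : IntervalIntegrable (fun x => Real.cos (Φ x) * (ψ x * mm (ψ x))) volume a b :=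
    Continuous.intervalIntegrable (by fun_prop) _ _
  have i2 : IntervalIntegrable (fun x => Real.sin (Φ x) * (p' x * mm (ψ x) + pp ξ n x * (mmd (ψ x) * (k * q' x)))) volume a b := by
    apply ContinuousOn.intervalIntegrable
    apply ContinuousOn.mul (by fun_prop)
    apply ContinuousOn.add
    · exact cp'.mul cm.continuousOn
    · exact cp.mul (by fun_prop)
  have key := intervalIntegral.integral_eq_sub_of_hasDerivAt (fun x hx => dF x (hpos x hx))
    ((i1.const_mul (2 * Real.pi)).add i2)
  rw [intervalIntegral.integral_add (i1.const_mul _) i2, intervalIntegral.integral_const_mul] at key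
  -- bound on the second integral
  set σ : ℝ := if 0 ≤ k then 1 else -1 with hσ
  have hσk : |k| = σ * k := by
    rw [hσ]; split_ifs with h
    · rw [abs_of_nonneg h]; ring
    · rw [abs_of_neg (not_le.1 h)]; ring
  have hσ1 : |σ| = 1 := by rw [hσ]; split_ifs <;> simp
  have dG : ∀ x, 0 < x → HasDerivAt (fun x => - pp ξ n x + 2 * pp ξ n a * (σ * Real.arctan (ψ x)))
      (- p' x + 2 * pp ξ n a * (σ * (1 / (1 + ψ x ^ 2) * (k * q' x)))) x := by
    intro x hx
    exact (dp x hx).neg.add ((((dψ x).arctan).const_mul σ).const_mul _)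
  have i3 : IntervalIntegrable (fun x => - p' x + 2 * pp ξ n a * (σ * (1 / (1 + ψ x ^ 2) * (k * q' x)))) volume a b := by
    apply ContinuousOn.intervalIntegrable
    apply ContinuousOn.add cp'.neg
    apply Continuous.continuousOn
    have : Continuous fun x => 1 / (1 + ψ x ^ 2) := by
      apply Continuous.div (by fun_prop) (by fun_prop)
      intro x; positivity
    fun_prop
  have key2 := intervalIntegral.integral_eq_sub_of_hasDerivAt (fun x hx => dG x (hpos x hx)) i3
  have hple : ∀ x ∈ Set.Icc a b, pp ξ n x ≤ pp ξ n a := by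
    intro x hx
    unfold pp
    have := hx.1
    gcongr
  have hbd : |∫ x in a..b, Real.sin (Φ x) * (p' x * mm (ψ x) + pp ξ n x * (mmd (ψ x) * (k * q' x)))|
      ≤ ∫ x in a..b, (- p' x + 2 * pp ξ n a * (σ * (1 / (1 + ψ x ^ 2) * (k * q' x)))) := by
    rw [← Real.norm_eq_abs]
    apply intervalIntegral.norm_integral_le_of_norm_le hab _ i3
    refine ae_of_all _ fun x hx => ?_
    have hx' : x ∈ Set.Icc a b := ⟨hx.1.le, hx.2⟩
    have hx0 : 0 < x := lt_of_lt_of_le ha hx'.1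
    rw [Real.norm_eq_abs, abs_mul]
    have hp'0 : p' x ≤ 0 := by
      simp only [hp']
      rw [neg_div]
      have : 0 ≤ (ξ * (n+1) * (n * x ^ (n-1))) / (ξ * (n + 1) * x ^ n) ^ 2 := by positivity
      linarith
    have hq0 : 0 ≤ q' x := by simp only [hq']; positivity
    have hpx := pp_pos n hξ hx0
    calc |Real.sin (Φ x)| * |p' x * mm (ψ x) + pp ξ n x * (mmd (ψ x) * (k * q' x))|
        ≤ 1 * |p' x * mm (ψ x) + pp ξ n x * (mmd (ψ x) * (k * q' x))| := by
          gcongr; exact Real.abs_sin_le_one _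
      _ ≤ |p' x * mm (ψ x)| + |pp ξ n x * (mmd (ψ x) * (k * q' x))| := by
          rw [one_mul]; exact abs_add_le _ _
      _ = (-p' x) * |mm (ψ x)| + pp ξ n x * (|mmd (ψ x)| * (|k| * q' x)) := by
          simp only [abs_mul, abs_of_nonpos hp'0, abs_of_pos hpx, abs_of_nonneg hq0]
      _ ≤ (-p' x) * 1 + pp ξ n a * ((2 * (1 / (1 + ψ x ^ 2))) * (|k| * q' x)) := by
          have h1 := abs_mm_le (ψ x)
          have h2 := abs_mmd_le (ψ x)
          have h3 := hple x hx'
          have h4 : 0 ≤ -p' x := by linarith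
          have h5 : 0 ≤ |k| * q' x := by positivity
          have h6 := pp_pos n hξ ha
          gcongr
      _ = _ := by rw [hσk]; ring
  have hb0 : 0 < b := lt_of_lt_of_le ha hab
  have e1 : ∀ x, |σ * Real.arctan (ψ x)| ≤ Real.pi / 2 := by
    intro x
    rw [abs_mul, hσ1, one_mul, abs_le]
    exact ⟨(Real.neg_pi_div_two_lt_arctan _).le, (Real.arctan_lt_pi_div_two _).le⟩
  have hpa := pp_pos n hξ ha
  have hpb := pp_pos n hξ hb0
  have hpab := hple b ⟨hab, le_refl _⟩
  rw [key2] at hbd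
  have hF : ∀ x, 0 < pp ξ n x → pp ξ n x ≤ pp ξ n a → |Real.sin (Φ x) * (pp ξ n x * mm (ψ x))| ≤ pp ξ n a := by
    intro x h0 hx
    rw [abs_mul, abs_mul, abs_of_pos h0]
    calc _ ≤ 1 * (pp ξ n a * 1) := by
          gcongr
          · exact Real.abs_sin_le_one _
          · exact abs_mm_le _
      _ = _ := by ring
  have hFa := hF a hpa le_rfl
  have hFb := hF b hpb hpab
  have ea := e1 a
  have eb := e1 b
  have h3 := Real.pi_gt_three
  have h2p : 2 * pp ξ n a * (σ * Real.arctan (ψ b)) - 2 * pp ξ n a * (σ * Real.arctan (ψ a)) ≤ 2 * pp ξ n a * Real.pi := by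
    rw [← mul_sub]
    apply mul_le_mul_of_nonneg_left _ (by positivity)
    have := abs_le.1 ea
    have := abs_le.1 eb
    linarith
  have hfin : 2 * Real.pi * |∫ x in a..b, Real.cos (Φ x) * (ψ x * mm (ψ x))| ≤ 2 * Real.pi * (2 * pp ξ n a) := by
    rw [← abs_of_pos (by positivity : 0 < 2 * Real.pi), ← abs_mul, abs_of_pos (by positivity : 0 < 2 * Real.pi)]
    have hpp3 : pp ξ n a * 3 ≤ pp ξ n a * Real.pi := by gcongr
    rw [abs_le] at hbd hFa hFb ⊢
    constructor <;> nlinarith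
  exact le_of_mul_le_mul_left hfin (by positivity)

lemma osc_bound (ξ a b : ℝ) (n e : ℕ) (j k θ : ℝ) (hξ : 0 < ξ) (ha : 0 < a) (hab : a ≤ b) :
    |∫ x in a..b, Real.cos (2 * Real.pi * (ξ * (j * x ^ (n+1) + k * x ^ (n+1+e))) + θ)|
      ≤ (∫ x in a..b, ww (j + k * qq n e x)) + 2 * pp ξ n a := by
  have h := osc_main ξ a b n e j k θ hξ ha hab
  have cq := continuous_qq n e
  have cw : Continuous fun x => ww (j + k * qq n e x) := continuous_ww.comp (by fun_prop)
  have cm : Continuous fun x => mm (j + k * qq n e x) := continuous_mm.comp (by fun_prop)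
  have e1 : (∫ x in a..b, Real.cos (2 * Real.pi * (ξ * (j * x ^ (n+1) + k * x ^ (n+1+e))) + θ)) =
    (∫ x in a..b, Real.cos (2 * Real.pi * (ξ * (j * x ^ (n+1) + k * x ^ (n+1+e))) + θ) * ww (j + k * qq n e x))
    + ∫ x in a..b, Real.cos (2 * Real.pi * (ξ * (j * x ^ (n+1) + k * x ^ (n+1+e))) + θ) *
      ((j + k * qq n e x) * mm (j + k * qq n e x)) := by
    rw [← intervalIntegral.integral_add]
    · congr 1; funext x
      rw [← mul_add, ww_add, mul_one]
    · exact Continuous.intervalIntegrable (by fun_prop) _ _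
    · exact Continuous.intervalIntegrable (by fun_prop) _ _
  rw [e1]
  refine (abs_add_le _ _).trans (add_le_add ?_ h)
  rw [← Real.norm_eq_abs]
  apply intervalIntegral.norm_integral_le_of_norm_le hab _ (cw.intervalIntegrable _ _)
  refine ae_of_all _ fun x hx => ?_
  rw [norm_mul, Real.norm_eq_abs, Real.norm_eq_abs, abs_of_nonneg (ww_nonneg _)]
  exact mul_le_of_le_one_left (ww_nonneg _) (Real.abs_cos_le_one _)

lemma osc_single (ξ a b : ℝ) (n : ℕ) (j θ : ℝ) (hj : 1 ≤ j) (hξ : 0 < ξ) (ha : 0 < a) (hab : a ≤ b) :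
    |∫ x in a..b, Real.cos (2 * Real.pi * j * (ξ * x ^ (n+1)) + θ)| ≤ 4 * pp ξ n a := by
  have h := osc_main ξ a b n 0 j 0 θ hξ ha hab
  simp only [zero_mul, add_zero] at h
  rw [intervalIntegral.integral_mul_const, abs_mul] at h
  have e1 : ∀ x : ℝ, 2 * Real.pi * (ξ * (j * x ^ (n+1))) + θ = 2 * Real.pi * j * (ξ * x ^ (n+1)) + θ := by
    intro x; ring
  simp only [e1] at h
  have h1 : (1:ℝ)/2 ≤ |j * mm j| := by
    refine le_trans ?_ (le_abs_self _)
    have h2 := ww_add j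
    have h3 : ww j ≤ 1/2 := by
      unfold ww
      apply one_div_le_one_div_of_le (by norm_num)
      nlinarith [sq_nonneg (j^2), mul_self_nonneg (j - 1)]
    linarith
  have h4 := abs_nonneg (∫ x in a..b, Real.cos (2 * Real.pi * j * (ξ * x ^ (n+1)) + θ))
  nlinarith

lemma arctan_step (t : ℝ) : 1 / (1 + t ^ 2) ≤ 3 * (Real.arctan (t + 1) - Real.arctan t) := by
  obtain ⟨c, hc, h⟩ := exists_hasDerivAt_eq_slope Real.arctan (fun x => 1 / (1 + x ^ 2)) (by linarith : t < t + 1)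
    Real.continuous_arctan.continuousOn (fun x _ => Real.hasDerivAt_arctan x)
  have h' : 1 / (1 + c ^ 2) = Real.arctan (t + 1) - Real.arctan t := by
    rw [h]; ring
  rw [← h', mul_one_div, div_le_div_iff₀ (by positivity) (by positivity)]
  have h1 := hc.1
  have h2 := hc.2
  nlinarith [sq_nonneg (2*t - c), sq_nonneg (t-1), sq_nonneg (t+1), mul_pos (sub_pos.2 h1) (sub_pos.2 h2)]

lemma ww_sum (d : ℕ) (y : ℝ) (hy : 0 < y) :
    ∑ j ∈ Finset.Icc 1 d, (1 / (j:ℝ)) * ww (j - y) ≤ 20 / y := by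
  have h1 : ∀ j ∈ Finset.Icc 1 d, (1 / (j:ℝ)) * ww (j - y) ≤ (1 / y) * (6 * (Real.arctan ((j:ℝ) + 1 - y) - Real.arctan (j - y))) := by
    intro j hj
    have hj1 : (1:ℝ) ≤ j := by exact_mod_cast (Finset.mem_Icc.1 hj).1
    have hs := arctan_step ((j:ℝ) - y)
    have e1 : (j:ℝ) - y + 1 = j + 1 - y := by ring
    rw [e1] at hs
    have : (1 / (j:ℝ)) * ww (j - y) ≤ (1 / y) * (2 * (1 / (1 + ((j:ℝ) - y)^2))) := by
      unfold ww
      set t := (j:ℝ) - y with ht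
      have hyt : y = j - t := by rw [ht]; ring
      have h0 : (1 + t ^ 2) ≠ 0 := by positivity
      rw [div_mul_div_comm, mul_div_assoc', div_mul_div_comm, div_le_div_iff₀ (by positivity) (by positivity)]
      have h2 : y ≤ 2 * j * (1 + t^2) := by
        rw [hyt]
        nlinarith [sq_nonneg (t+1), mul_nonneg (sub_nonneg.2 hj1) (sq_nonneg t)]
      have : 0 < 1 + t ^ 2 := by positivity
      nlinarith [mul_le_mul_of_nonneg_right h2 this.le]
    refine this.trans (mul_le_mul_of_nonneg_left (by linarith) (by positivity))
  refine (Finset.sum_le_sum h1).trans ?_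
  rw [← Finset.mul_sum, ← Finset.mul_sum]
  have tel : ∀ d : ℕ, ∑ j ∈ Finset.Icc 1 d, (Real.arctan ((j:ℝ) + 1 - y) - Real.arctan (j - y)) = Real.arctan ((d:ℝ) + 1 - y) - Real.arctan (1 - y) := by
    intro d
    induction d with
    | zero => simp
    | succ d ih =>
      rw [Finset.sum_Icc_succ_top (by omega), ih]; push_cast; ring
  rw [tel, div_eq_mul_one_div 20 y, mul_comm 20]
  gcongr
  have := Real.arctan_lt_pi_div_two ((d:ℝ) + 1 - y)
  have := Real.neg_pi_div_two_lt_arctan (1 - y)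
  have := Real.pi_lt_d2
  linarith

lemma bv_memLp (f : ℝ → ℝ) (hv : eVariationOn f (Set.Icc (0:ℝ) 1) ≤ 2) :
    MemLp f 2 (volume.restrict (Set.Icc (0:ℝ) 1)) := by
  have hb : BoundedVariationOn f (Set.Icc (0:ℝ) 1) := ne_top_of_le_ne_top (by simp) hv
  obtain ⟨p, q, hp, hq, h⟩ := hb.locallyBoundedVariationOn.exists_monotoneOn_sub_monotoneOn
  rw [h]
  exact (hp.memLp_isCompact isCompact_Icc).sub (hq.memLp_isCompact isCompact_Icc)

lemma bv_int (f : ℝ → ℝ) (hv : eVariationOn f (Set.Icc (0:ℝ) 1) ≤ 2) :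
    IntervalIntegrable f volume 0 1 := by
  rw [intervalIntegrable_iff_integrableOn_Icc_of_le zero_le_one]
  exact (bv_memLp f hv).integrable (by norm_num)

lemma bv_int_sq (f : ℝ → ℝ) (hv : eVariationOn f (Set.Icc (0:ℝ) 1) ≤ 2) :
    IntervalIntegrable (fun x => f x ^ 2) volume 0 1 := by
  rw [intervalIntegrable_iff_integrableOn_Icc_of_le zero_le_one]
  exact (bv_memLp f hv).integrable_sq

lemma int_cos (j : ℝ) (hj : j ≠ 0) (θ a b : ℝ) :
    ∫ x in a..b, Real.cos (2 * Real.pi * j * x + θ) =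
      (Real.sin (2 * Real.pi * j * b + θ) - Real.sin (2 * Real.pi * j * a + θ)) / (2 * Real.pi * j) := by
  rw [intervalIntegral.integral_comp_mul_add (f := Real.cos) (by positivity) θ, integral_cos]
  rw [smul_eq_mul]; field_simp

lemma int_cos_per (j : ℤ) (hj : j ≠ 0) (θ : ℝ) :
    ∫ x in (0:ℝ)..1, Real.cos (2 * Real.pi * j * x + θ) = 0 := by
  rw [int_cos _ (by exact_mod_cast hj)]
  have : 2 * Real.pi * j * 1 + θ = (2 * Real.pi * j * 0 + θ) + j * (2 * Real.pi) := by ring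
  rw [this, Real.sin_add_int_mul_two_pi]; simp

lemma coef_bound (f : ℝ → ℝ) (hv : eVariationOn f (Set.Icc (0:ℝ) 1) ≤ 2) (j : ℕ) (hj : 1 ≤ j) (θ : ℝ) :
    |∫ x in (0:ℝ)..1, f x * Real.cos (2 * Real.pi * j * x + θ)| ≤ 2 / j := by
  have hj0 : (0:ℝ) < j := by exact_mod_cast hj
  set I : ℕ → ℝ := fun i => (i:ℝ) / j with hI
  have hmono : Monotone I := by
    intro a b hab
    simp only [hI]; gcongr
  have I0 : I 0 = 0 := by simp [hI]
  have Ij : I j = 1 := by simp only [hI]; field_simp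
  have hfi := bv_int f hv
  have cc : Continuous fun x : ℝ => Real.cos (2 * Real.pi * j * x + θ) := by fun_prop
  have hfc : IntervalIntegrable (fun x => f x * Real.cos (2 * Real.pi * j * x + θ)) volume 0 1 :=
    hfi.mul_continuousOn cc.continuousOn
  have hsub : ∀ i < j, Set.Icc (I i) (I (i+1)) ⊆ Set.Icc 0 1 := by
    intro i hi
    rw [← I0, ← Ij]
    exact Set.Icc_subset_Icc (hmono (Nat.zero_le _)) (hmono hi)
  have hii : ∀ i < j, IntervalIntegrable (fun x => f x * Real.cos (2 * Real.pi * j * x + θ)) volume (I i) (I (i+1)) := by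
    intro i hi
    apply hfc.mono_set
    rw [Set.uIcc_of_le (hmono (Nat.le_succ i)), Set.uIcc_of_le zero_le_one]
    exact hsub i hi
  have hsum := intervalIntegral.sum_integral_adjacent_intervals (a := I) (n := j) hii
  rw [I0, Ij] at hsum
  rw [← hsum]
  have hb : BoundedVariationOn f (Set.Icc (0:ℝ) 1) := ne_top_of_le_ne_top (by simp) hv
  have hv' := eVariationOn.sum' f hmono (n := j)
  rw [I0, Ij] at hv'
  have hloc : ∀ i < j, BoundedVariationOn f (Set.Icc (I i) (I (i+1))) := fun i hi => hb.mono (hsub i hi)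
  have hstep : ∀ i ∈ Finset.range j, |∫ x in (I i)..(I (i+1)), f x * Real.cos (2 * Real.pi * j * x + θ)| ≤
      (eVariationOn f (Set.Icc (I i) (I (i+1)))).toReal * (1 / j) := by
    intro i hi
    have hi' := Finset.mem_range.1 hi
    have hz : ∫ x in (I i)..(I (i+1)), Real.cos (2 * Real.pi * j * x + θ) = 0 := by
      rw [int_cos _ hj0.ne']
      have : 2 * Real.pi * j * I (i+1) + θ = 2 * Real.pi * j * I i + θ + 2 * Real.pi := by
        simp only [hI]; push_cast; field_simp; ring
      rw [this, Real.sin_add_two_pi]; simp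
    have e1 : ∫ x in (I i)..(I (i+1)), f x * Real.cos (2 * Real.pi * j * x + θ) =
        ∫ x in (I i)..(I (i+1)), (f x - f (I i)) * Real.cos (2 * Real.pi * j * x + θ) := by
      simp only [sub_mul]
      rw [intervalIntegral.integral_sub (hii i hi') (Continuous.intervalIntegrable (by fun_prop) _ _),
        intervalIntegral.integral_const_mul, hz]; simp
    rw [e1, ← Real.norm_eq_abs]
    have hle : I i ≤ I (i+1) := hmono (Nat.le_succ i)
    have := intervalIntegral.norm_integral_le_of_norm_le_const (a := I i) (b := I (i+1))
      (f := fun x => (f x - f (I i)) * Real.cos (2 * Real.pi * j * x + θ)) (C := (eVariationOn f (Set.Icc (I i) (I (i+1)))).toReal) ?_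
    · refine this.trans (le_of_eq ?_)
      congr 1
      rw [abs_of_nonneg (by linarith)]
      simp only [hI]; push_cast; field_simp; ring
    · intro x hx
      rw [Set.uIoc_of_le hle] at hx
      rw [norm_mul]
      have h1 := (hloc i hi').dist_le (x := x) (y := I i) ⟨hx.1.le, hx.2⟩ ⟨le_rfl, hle⟩
      rw [Real.dist_eq, ← Real.norm_eq_abs] at h1
      have h2 : ‖Real.cos (2 * Real.pi * j * x + θ)‖ ≤ 1 := Real.abs_cos_le_one _
      calc _ ≤ (eVariationOn f (Set.Icc (I i) (I (i+1)))).toReal * 1 := by gcongr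
        _ = _ := by ring
  calc _ ≤ ∑ i ∈ Finset.range j, |∫ x in (I i)..(I (i+1)), f x * Real.cos (2 * Real.pi * j * x + θ)| :=
        Finset.abs_sum_le_sum_abs _ _
    _ ≤ ∑ i ∈ Finset.range j, (eVariationOn f (Set.Icc (I i) (I (i+1)))).toReal * (1 / j) := Finset.sum_le_sum hstep
    _ = (eVariationOn f (Set.Icc (0:ℝ) 1)).toReal * (1 / j) := by
        rw [← Finset.sum_mul, ← hv', ENNReal.toReal_sum]
        intro i hi
        exact hloc i (Finset.mem_range.1 hi)
    _ ≤ 2 * (1 / j) := by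
        gcongr
        exact ENNReal.toReal_le_of_le_ofReal (by norm_num) (by simpa using hv)
    _ = _ := by ring

lemma cos_orth (j k : ℕ) (hj : 1 ≤ j) (hk : 1 ≤ k) (α β : ℝ) (hαβ : j = k → α = β) :
    ∫ x in (0:ℝ)..1, Real.cos (2 * Real.pi * j * x + α) * Real.cos (2 * Real.pi * k * x + β) =
      if j = k then 1/2 else 0 := by
  have e : ∀ x : ℝ, Real.cos (2 * Real.pi * j * x + α) * Real.cos (2 * Real.pi * k * x + β) =
      (1/2) * Real.cos (2 * Real.pi * ((j + k : ℤ) : ℝ) * x + (α + β)) + (1/2) * Real.cos (2 * Real.pi * ((j - k : ℤ) : ℝ) * x + (α - β)) := by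
    intro x
    have h1 : 2 * Real.pi * ((j + k : ℤ) : ℝ) * x + (α + β) = (2 * Real.pi * j * x + α) + (2 * Real.pi * k * x + β) := by
      push_cast; ring
    have h2 : 2 * Real.pi * ((j - k : ℤ) : ℝ) * x + (α - β) = (2 * Real.pi * j * x + α) - (2 * Real.pi * k * x + β) := by
      push_cast; ring
    rw [h1, h2, Real.cos_add (2 * Real.pi * j * x + α), Real.cos_sub (2 * Real.pi * j * x + α)]; ring
  simp only [e]
  rw [intervalIntegral.integral_add (Continuous.intervalIntegrable (by fun_prop) _ _) (Continuous.intervalIntegrable (by fun_prop) _ _),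
    intervalIntegral.integral_const_mul, intervalIntegral.integral_const_mul, int_cos_per _ (by omega)]
  split_ifs with h
  · simp [h, hαβ h]
  · rw [int_cos_per _ (by omega)]; simp

lemma fourier_repr (f : ℝ → ℝ) (hv : eVariationOn f (Set.Icc (0:ℝ) 1) ≤ 2) :
    ∃ r θ : ℕ → ℝ, (∀ j, 0 ≤ r j) ∧ (∀ j, 1 ≤ j → r j ≤ 4 / j) ∧
      (∀ d, ∑ j ∈ Finset.Icc 1 d, r j ^ 2 ≤ 2 * ∫ x in (0:ℝ)..1, f x ^ 2) ∧
      ∀ d y, fourierPartial f d y = ∑ j ∈ Finset.Icc 1 d, r j * Real.cos (2 * Real.pi * j * y + θ j) := by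
  set z : ℕ → ℂ := fun j => ⟨fourierA f j, fourierB f j⟩ with hz
  set r : ℕ → ℝ := fun j => ‖z j‖ with hr
  set θ : ℕ → ℝ := fun j => - (z j).arg with hθ
  have ha : ∀ j, fourierA f j = r j * Real.cos (θ j) := by
    intro j; simp only [hr, hθ, Real.cos_neg, Complex.norm_mul_cos_arg]; rfl
  have hb : ∀ j, fourierB f j = - (r j * Real.sin (θ j)) := by
    intro j; simp only [hr, hθ, Real.sin_neg, mul_neg, neg_neg, Complex.norm_mul_sin_arg]; rfl
  have hfi := bv_int f hv
  have hfc : ∀ j : ℕ, ∀ t : ℝ, IntervalIntegrable (fun x => f x * Real.cos (2 * Real.pi * j * x + t)) volume 0 1 :=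
    fun j t => hfi.mul_continuousOn (by fun_prop)
  have hri : ∀ j : ℕ, r j = 2 * ∫ x in (0:ℝ)..1, f x * Real.cos (2 * Real.pi * j * x + θ j) := by
    intro j
    have e : ∀ x : ℝ, f x * Real.cos (2 * Real.pi * j * x + θ j) = Real.cos (θ j) * (f x * Real.cos (2 * Real.pi * j * x)) -
        Real.sin (θ j) * (f x * Real.sin (2 * Real.pi * j * x)) := by
      intro x; rw [Real.cos_add]; ring
    simp only [e]
    have i1 : IntervalIntegrable (fun x => f x * Real.cos (2 * Real.pi * j * x)) volume 0 1 := hfi.mul_continuousOn (by fun_prop)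
    have i2 : IntervalIntegrable (fun x => f x * Real.sin (2 * Real.pi * j * x)) volume 0 1 := hfi.mul_continuousOn (by fun_prop)
    rw [intervalIntegral.integral_sub (i1.const_mul _) (i2.const_mul _), intervalIntegral.integral_const_mul,
      intervalIntegral.integral_const_mul]
    have h1 := ha j
    have h2 := hb j
    unfold fourierA at h1
    unfold fourierB at h2
    have h3 := Real.sin_sq_add_cos_sq (θ j)
    linear_combination (-r j) * h3 - Real.cos (θ j) * h1 + Real.sin (θ j) * h2
  refine ⟨r, θ, fun j => norm_nonneg _, ?_, ?_, ?_⟩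
  · intro j hj
    rw [hri j]
    have := (abs_le.1 (coef_bound f hv j hj (θ j))).2
    have e : (4:ℝ) / j = 2 * (2 / j) := by ring
    rw [e]; linarith
  · intro d
    set g : ℝ → ℝ := fun x => ∑ j ∈ Finset.Icc 1 d, r j * Real.cos (2 * Real.pi * j * x + θ j) with hg
    have cg : Continuous g := by fun_prop
    have ifg : IntervalIntegrable (fun x => f x * g x) volume 0 1 := hfi.mul_continuousOn cg.continuousOn
    have h1 : ∫ x in (0:ℝ)..1, f x * g x = ∑ j ∈ Finset.Icc 1 d, r j ^ 2 / 2 := by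
      simp only [hg, Finset.mul_sum]
      rw [intervalIntegral.integral_finsetSum]
      · refine Finset.sum_congr rfl fun j _ => ?_
        have : ∀ x, f x * (r j * Real.cos (2 * Real.pi * j * x + θ j)) = r j * (f x * Real.cos (2 * Real.pi * j * x + θ j)) := by
          intro x; ring
        simp only [this]
        rw [intervalIntegral.integral_const_mul]
        have := hri j
        linear_combination (-r j/2) * this
      · intro j _
        exact hfi.mul_continuousOn (by fun_prop)
    have h2 : ∫ x in (0:ℝ)..1, g x * g x = ∑ j ∈ Finset.Icc 1 d, r j ^ 2 / 2 := by
      simp only [hg, Finset.sum_mul_sum]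
      rw [intervalIntegral.integral_finsetSum]
      · refine Finset.sum_congr rfl fun j hj => ?_
        rw [intervalIntegral.integral_finsetSum]
        · have : ∀ k ∈ Finset.Icc 1 d, ∫ x in (0:ℝ)..1, r j * Real.cos (2 * Real.pi * j * x + θ j) * (r k * Real.cos (2 * Real.pi * k * x + θ k))
            = if j = k then r j ^ 2 / 2 else 0 := by
            intro k hk
            have e : ∀ x, r j * Real.cos (2 * Real.pi * j * x + θ j) * (r k * Real.cos (2 * Real.pi * k * x + θ k)) =
              (r j * r k) * (Real.cos (2 * Real.pi * j * x + θ j) * Real.cos (2 * Real.pi * k * x + θ k)) := by intro x; ring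
            simp only [e]
            rw [intervalIntegral.integral_const_mul, cos_orth j k (Finset.mem_Icc.1 hj).1 (Finset.mem_Icc.1 hk).1 _ _ (fun h => by rw [h])]
            split_ifs with h
            · rw [h]; ring
            · ring
          rw [Finset.sum_congr rfl this, Finset.sum_ite_eq, if_pos hj]
        · intro k _
          exact Continuous.intervalIntegrable (by fun_prop) _ _
      · intro k _
        exact Continuous.intervalIntegrable (by fun_prop) _ _
    have h3 : 0 ≤ ∫ x in (0:ℝ)..1, (f x - g x) ^ 2 :=
      intervalIntegral.integral_nonneg zero_le_one fun x _ => sq_nonneg _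
    have e : ∀ x, (f x - g x) ^ 2 = f x ^ 2 - 2 * (f x * g x) + g x * g x := by intro x; ring
    simp only [e] at h3
    have ig : IntervalIntegrable (fun x => g x * g x) volume 0 1 := Continuous.intervalIntegrable (by fun_prop) _ _
    rw [intervalIntegral.integral_add ((bv_int_sq f hv).sub (ifg.const_mul 2)) ig,
      intervalIntegral.integral_sub (bv_int_sq f hv) (ifg.const_mul 2), intervalIntegral.integral_const_mul, h1, h2,
      ← Finset.sum_div] at h3
    linarith
  · intro d y
    unfold fourierPartial
    refine Finset.sum_congr rfl fun j _ => ?_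
    rw [ha, hb, Real.cos_add]; ring

lemma fnorm_eq (A B : ℝ) (hAB : B - A = 1) (f : ℝ → ℝ) (hper : ∀ x, f (x + 1) = f x) :
    fnorm A B f ^ 2 = ∫ x in (0:ℝ)..1, f x ^ 2 := by
  have hp : Function.Periodic (fun x => f x ^ 2) 1 := fun x => by simp only [hper]
  have := hp.intervalIntegral_add_eq A 0
  have hB : B = A + 1 := by linarith
  unfold fnorm
  rw [Real.sq_sqrt, hB, this, zero_add]
  apply intervalIntegral.integral_nonneg (by linarith)
  intro x _; positivity

noncomputable def gg (r θ : ℕ → ℝ) (d : ℕ) (y : ℝ) : ℝ :=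
  ∑ j ∈ Finset.Icc 1 d, r j * Real.cos (2 * Real.pi * j * y + θ j)

/-- standing hypotheses on the coefficients -/
structure Coef (r : ℕ → ℝ) (d : ℕ) (F : ℝ) : Prop where
  nonneg : ∀ j, 0 ≤ r j
  le4 : ∀ j, 1 ≤ j → r j ≤ 4 / j
  Fnn : 0 ≤ F
  sq : ∑ j ∈ Finset.Icc 1 d, r j ^ 2 ≤ 2 * F ^ 2

@[fun_prop]
lemma continuous_gg (r θ : ℕ → ℝ) (d : ℕ) : Continuous (gg r θ d) := by
  unfold gg; fun_prop

lemma Coef.le_four {r : ℕ → ℝ} {d : ℕ} {F : ℝ} (h : Coef r d F) {j : ℕ} (hj : j ∈ Finset.Icc 1 d) : r j ≤ 4 := by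
  have h1 := (Finset.mem_Icc.1 hj).1
  refine (h.le4 j h1).trans ?_
  have : (1:ℝ) ≤ j := by exact_mod_cast h1
  exact div_le_self (by norm_num) this

lemma sum_inv_sq (d : ℕ) : ∑ k ∈ Finset.Icc 1 d, (1 / (k:ℝ)) ^ 2 ≤ 2 := by
  have h := sum_Ioo_inv_sq_le (α := ℝ) 0 (d+1)
  have e : Finset.Ioo 0 (d+1) = Finset.Icc 1 d := by ext; simp; omega
  rw [e] at h
  refine le_trans (le_of_eq ?_) (h.trans (by norm_num))
  refine Finset.sum_congr rfl fun k _ => ?_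
  rw [one_div, inv_pow]

lemma Coef.sum_div {r : ℕ → ℝ} {d : ℕ} {F : ℝ} (h : Coef r d F) :
    ∑ k ∈ Finset.Icc 1 d, r k * (1 / (k:ℝ)) ≤ 2 * F := by
  have hc := Finset.sum_mul_sq_le_sq_mul_sq (Finset.Icc 1 d) r (fun k => 1 / (k:ℝ))
  have h0 : 0 ≤ ∑ k ∈ Finset.Icc 1 d, r k ^ 2 := Finset.sum_nonneg fun k _ => sq_nonneg _
  have h1 : (∑ k ∈ Finset.Icc 1 d, r k * (1 / (k:ℝ))) ^ 2 ≤ (2 * F) ^ 2 := by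
    refine hc.trans ?_
    calc _ ≤ (2 * F^2) * 2 := by
          gcongr
          · exact h.sq
          · exact sum_inv_sq d
      _ = _ := by ring
  exact abs_le_of_sq_le_sq' h1 (by have := h.Fnn; positivity) |>.2

lemma ww_mono_sign (j k q : ℝ) (hj : 0 ≤ j) (hk : 0 ≤ k) (hq : 0 ≤ q) : ww (j + k * q) ≤ ww (j - k * q) := by
  unfold ww
  have : 0 ≤ j * (k * q) := by positivity
  apply one_div_le_one_div_of_le (by positivity)
  gcongr 2
  have h : (1:ℝ) + (j - k*q)^2 ≤ 1 + (j + k*q)^2 := by nlinarith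
  nlinarith

lemma pair_bound {r θ : ℕ → ℝ} {d : ℕ} {F : ℝ} (h : Coef r d F) (ξ A a b : ℝ) (n e : ℕ)
    (hξ : 0 < ξ) (hA : 1 ≤ A) (ha : A ≤ a) (hab : a ≤ b) :
    ∫ x in a..b, gg r θ d (ξ * x ^ (n+1)) * gg r θ d (ξ * x ^ (n+1+e)) ≤
      160 * F * (1 / A) ^ e * (b - a) + 32 * d ^ 2 * pp ξ n a := by
  have hA0 : 0 < A := by linarith
  have ha0 : 0 < a := by linarith
  have hpa := pp_pos n hξ ha0
  have cq := continuous_qq n e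
  have cw : ∀ j k : ℝ, Continuous fun x => ww (j - k * qq n e x) := fun j k => continuous_ww.comp (by fun_prop)
  have cw' : ∀ j k : ℝ, Continuous fun x => ww (j + k * qq n e x) := fun j k => continuous_ww.comp (by fun_prop)
  have hq0 : ∀ x ∈ Set.Icc a b, A ^ e ≤ qq n e x := by
    intro x hx
    unfold qq
    have h1 : A ^ e ≤ x ^ e := pow_le_pow_left₀ hA0.le (ha.trans hx.1) e
    have h2 : (1:ℝ) ≤ (n + 1 + e : ℝ) / (n + 1) := by
      rw [one_le_div (by positivity)]; linarith [Nat.cast_nonneg (α := ℝ) e]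
    have h3 : 0 ≤ A ^ e := by positivity
    nlinarith
  have term : ∀ j ∈ Finset.Icc 1 d, ∀ k ∈ Finset.Icc 1 d,
      ∫ x in a..b, (r j * Real.cos (2 * Real.pi * j * (ξ * x ^ (n+1)) + θ j)) * (r k * Real.cos (2 * Real.pi * k * (ξ * x ^ (n+1+e)) + θ k))
      ≤ (∫ x in a..b, r j * r k * ww (j - k * qq n e x)) + 32 * pp ξ n a := by
    intro j hj k hk
    have e1 : ∀ x : ℝ, (r j * Real.cos (2 * Real.pi * j * (ξ * x ^ (n+1)) + θ j)) * (r k * Real.cos (2 * Real.pi * k * (ξ * x ^ (n+1+e)) + θ k))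
      = (r j * r k) * ((1/2) * Real.cos (2 * Real.pi * (ξ * (j * x ^ (n+1) + k * x ^ (n+1+e))) + (θ j + θ k)) +
         (1/2) * Real.cos (2 * Real.pi * (ξ * (j * x ^ (n+1) + (-k) * x ^ (n+1+e))) + (θ j - θ k))) := by
      intro x
      have h1 : 2 * Real.pi * (ξ * (j * x ^ (n+1) + k * x ^ (n+1+e))) + (θ j + θ k) =
        (2 * Real.pi * j * (ξ * x ^ (n+1)) + θ j) + (2 * Real.pi * k * (ξ * x ^ (n+1+e)) + θ k) := by ring
      have h2 : 2 * Real.pi * (ξ * (j * x ^ (n+1) + (-k) * x ^ (n+1+e))) + (θ j - θ k) =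
        (2 * Real.pi * j * (ξ * x ^ (n+1)) + θ j) - (2 * Real.pi * k * (ξ * x ^ (n+1+e)) + θ k) := by ring
      rw [h1, h2, Real.cos_add (2 * Real.pi * j * (ξ * x ^ (n+1)) + θ j), Real.cos_sub (2 * Real.pi * j * (ξ * x ^ (n+1)) + θ j)]
      ring
    simp only [e1]
    rw [intervalIntegral.integral_const_mul, intervalIntegral.integral_const_mul,
      intervalIntegral.integral_add (Continuous.intervalIntegrable (by fun_prop) _ _) (Continuous.intervalIntegrable (by fun_prop) _ _),
      intervalIntegral.integral_const_mul, intervalIntegral.integral_const_mul]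
    have b1 := (le_abs_self _).trans (osc_bound ξ a b n e j k (θ j + θ k) hξ ha0 hab)
    have b2 := (le_abs_self _).trans (osc_bound ξ a b n e j (-k) (θ j - θ k) hξ ha0 hab)
    have b3 : (∫ x in a..b, ww (j + k * qq n e x)) ≤ ∫ x in a..b, ww (j - k * qq n e x) := by
      apply intervalIntegral.integral_mono_on hab ((cw' _ _).intervalIntegrable _ _) ((cw _ _).intervalIntegrable _ _)
      intro x hx
      exact ww_mono_sign _ _ _ (by positivity) (by positivity) (le_trans (by positivity) (hq0 x hx))
    have e4 : (∫ x in a..b, ww (j + (-k) * qq n e x)) = ∫ x in a..b, ww (j - k * qq n e x) := by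
      simp only [neg_mul, sub_eq_add_neg]
    rw [e4] at b2
    have hr : 0 ≤ r j * r k := mul_nonneg (h.nonneg j) (h.nonneg k)
    have hr16 : r j * r k ≤ 16 := by
      calc r j * r k ≤ 4 * 4 := mul_le_mul (h.le_four hj) (h.le_four hk) (h.nonneg k) (by norm_num)
        _ = 16 := by norm_num
    have b5 := mul_le_mul_of_nonneg_left (add_le_add (mul_le_mul_of_nonneg_left (b1.trans (add_le_add_left b3 _)) (by norm_num : (0:ℝ) ≤ 1/2))
      (mul_le_mul_of_nonneg_left b2 (by norm_num : (0:ℝ) ≤ 1/2))) hr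
    refine b5.trans ?_
    nlinarith
  have hswap : ∫ x in a..b, gg r θ d (ξ * x ^ (n+1)) * gg r θ d (ξ * x ^ (n+1+e)) =
      ∑ j ∈ Finset.Icc 1 d, ∑ k ∈ Finset.Icc 1 d, ∫ x in a..b, (r j * Real.cos (2 * Real.pi * j * (ξ * x ^ (n+1)) + θ j)) * (r k * Real.cos (2 * Real.pi * k * (ξ * x ^ (n+1+e)) + θ k)) := by
    simp only [gg, Finset.sum_mul_sum]
    rw [intervalIntegral.integral_finsetSum (fun _ _ => Continuous.intervalIntegrable (by fun_prop) _ _)]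
    refine Finset.sum_congr rfl fun j _ => ?_
    rw [intervalIntegral.integral_finsetSum (fun _ _ => Continuous.intervalIntegrable (by fun_prop) _ _)]
  rw [hswap]
  have hle := Finset.sum_le_sum fun j hj => Finset.sum_le_sum fun k hk => term j hj k hk
  refine hle.trans ?_
  simp only [Finset.sum_add_distrib, Finset.sum_const, Nat.card_Icc, Nat.add_sub_cancel, nsmul_eq_mul]
  have hcwi : ∀ j k : ℕ, Continuous fun x => r j * r k * ww (j - k * qq n e x) := fun j k => continuous_const.mul (cw j k)
  have hback : ∑ j ∈ Finset.Icc 1 d, ∑ k ∈ Finset.Icc 1 d, (∫ x in a..b, r j * r k * ww (j - k * qq n e x)) =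
      ∫ x in a..b, ∑ j ∈ Finset.Icc 1 d, ∑ k ∈ Finset.Icc 1 d, r j * r k * ww (j - k * qq n e x) := by
    rw [intervalIntegral.integral_finsetSum (fun j _ => Continuous.intervalIntegrable (continuous_finsetSum _ fun k _ => hcwi j k) _ _)]
    refine Finset.sum_congr rfl fun j _ => ?_
    rw [intervalIntegral.integral_finsetSum (fun k _ => Continuous.intervalIntegrable (hcwi j k) _ _)]
  rw [hback]
  have hpt : ∀ x ∈ Set.Icc a b, ∑ j ∈ Finset.Icc 1 d, ∑ k ∈ Finset.Icc 1 d, r j * r k * ww (j - k * qq n e x) ≤ 160 * F * (1 / A) ^ e := by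
    intro x hx
    have hq := hq0 x hx
    have hqpos : 0 < qq n e x := lt_of_lt_of_le (by positivity) hq
    rw [Finset.sum_comm]
    have h1 : ∀ k ∈ Finset.Icc 1 d, ∑ j ∈ Finset.Icc 1 d, r j * r k * ww (j - k * qq n e x) ≤ (80 * (1 / A) ^ e) * (r k * (1 / (k:ℝ))) := by
      intro k hk
      have hk1 : (1:ℝ) ≤ k := by exact_mod_cast (Finset.mem_Icc.1 hk).1
      calc _ ≤ ∑ j ∈ Finset.Icc 1 d, (4 * r k) * ((1 / (j:ℝ)) * ww (j - k * qq n e x)) := by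
            apply Finset.sum_le_sum
            intro j hj
            have := h.le4 j (Finset.mem_Icc.1 hj).1
            have h1 := mul_le_mul_of_nonneg_right this (mul_nonneg (h.nonneg k) (ww_nonneg (j - k * qq n e x)))
            calc _ = r j * (r k * ww (j - k * qq n e x)) := by ring
              _ ≤ _ := h1
              _ = _ := by ring
        _ = (4 * r k) * ∑ j ∈ Finset.Icc 1 d, ((1 / (j:ℝ)) * ww (j - k * qq n e x)) := by rw [Finset.mul_sum]
        _ ≤ (4 * r k) * (20 / (k * qq n e x)) := by
            apply mul_le_mul_of_nonneg_left (ww_sum d _ (by positivity))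
            have := h.nonneg k; positivity
        _ ≤ (4 * r k) * (20 / (k * A ^ e)) := by
            have := h.nonneg k
            gcongr
        _ = _ := by
            rw [one_div_pow]; field_simp; ring
    refine (Finset.sum_le_sum h1).trans ?_
    rw [← Finset.mul_sum]
    calc _ ≤ (80 * (1 / A) ^ e) * (2 * F) := by
          apply mul_le_mul_of_nonneg_left h.sum_div (by positivity)
      _ = _ := by ring
  have hint : ∫ x in a..b, ∑ j ∈ Finset.Icc 1 d, ∑ k ∈ Finset.Icc 1 d, r j * r k * ww (j - k * qq n e x) ≤ ∫ x in a..b, 160 * F * (1 / A) ^ e := by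
    apply intervalIntegral.integral_mono_on hab _ (by simp) hpt
    exact Continuous.intervalIntegrable (continuous_finsetSum _ fun j _ => continuous_finsetSum _ fun k _ => hcwi j k) _ _
  rw [intervalIntegral.integral_const, smul_eq_mul] at hint
  nlinarith

lemma geom_inj (ρ : ℝ) (h0 : 0 ≤ ρ) (h1 : ρ < 1) (S : Finset ℕ) (φ : ℕ → ℕ) (hφ : Set.InjOn φ S) :
    ∑ n ∈ S, ρ ^ φ n ≤ 1 / (1 - ρ) := by
  rw [← Finset.sum_image (f := fun k => ρ ^ k) hφ, one_div, ← tsum_geometric_of_lt_one h0 h1]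
  exact (summable_geometric_of_lt_one h0 h1).sum_le_tsum _ (fun i _ => by positivity)

lemma geom_two (ρ : ℝ) (h0 : 0 ≤ ρ) (h1 : ρ < 1) (T : Finset ℕ) (ω : ℕ → ℕ) (hω : StrictMono ω) (m : ℕ) :
    ∑ n ∈ T, ρ ^ ((ω n - ω m) + (ω m - ω n)) ≤ 2 / (1 - ρ) := by
  rw [← Finset.sum_filter_add_sum_filter_not T (fun n => m ≤ n)]
  have a1 := geom_inj ρ h0 h1 (T.filter (fun n => m ≤ n)) (fun n => (ω n - ω m) + (ω m - ω n)) (by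
    intro x hx y hy hxy
    have hx' := (Finset.mem_filter.1 (Finset.mem_coe.1 hx)).2
    have hy' := (Finset.mem_filter.1 (Finset.mem_coe.1 hy)).2
    have := hω.monotone hx'
    have := hω.monotone hy'
    simp only at hxy
    exact hω.injective (by omega))
  have a2 := geom_inj ρ h0 h1 (T.filter (fun n => ¬ m ≤ n)) (fun n => (ω n - ω m) + (ω m - ω n)) (by
    intro x hx y hy hxy
    have hx' := (Finset.mem_filter.1 (Finset.mem_coe.1 hx)).2
    have hy' := (Finset.mem_filter.1 (Finset.mem_coe.1 hy)).2
    have := hω.monotone (not_le.1 hx').le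
    have := hω.monotone (not_le.1 hy').le
    simp only at hxy
    exact hω.injective (by omega))
  have : 2 / (1 - ρ) = 1 / (1 - ρ) + 1 / (1 - ρ) := by ring
  rw [this]
  exact add_le_add a1 a2

lemma pp_anti (ξ a : ℝ) (n m : ℕ) (hnm : n ≤ m) (hξ : 0 < ξ) (ha : 1 ≤ a) : pp ξ m a ≤ pp ξ n a := by
  unfold pp
  have : a ^ n ≤ a ^ m := pow_le_pow_right₀ ha hnm
  gcongr

/-- block sum -/
noncomputable def UU (r θ : ℕ → ℝ) (d : ℕ) (ξ : ℝ) (ω : ℕ → ℕ) (T : Finset ℕ) (x : ℝ) : ℝ :=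
  ∑ n ∈ T, gg r θ d (ξ * x ^ (ω n + 1))

@[fun_prop]
lemma continuous_UU (r θ : ℕ → ℝ) (d : ℕ) (ξ : ℝ) (ω : ℕ → ℕ) (T : Finset ℕ) : Continuous (UU r θ d ξ ω T) := by
  unfold UU; fun_prop

lemma pair_bound' {r θ : ℕ → ℝ} {d : ℕ} {F : ℝ} (h : Coef r d F) (ξ A a b : ℝ) (n0 p q : ℕ)
    (hp : n0 ≤ p) (hq : n0 ≤ q)
    (hξ : 0 < ξ) (hA : 1 ≤ A) (ha : A ≤ a) (hab : a ≤ b) :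
    ∫ x in a..b, gg r θ d (ξ * x ^ (p+1)) * gg r θ d (ξ * x ^ (q+1)) ≤
      160 * F * (1 / A) ^ ((q - p) + (p - q)) * (b - a) + 32 * d ^ 2 * pp ξ n0 a := by
  rcases le_total p q with hpq | hpq
  · obtain ⟨e, rfl⟩ := Nat.exists_eq_add_of_le hpq
    have := pair_bound (θ := θ) h ξ A a b p e hξ hA ha hab
    have e1 : p + e + 1 = p + 1 + e := by omega
    have e2 : p + e - p + (p - (p + e)) = e := by omega
    rw [e1, e2]
    refine this.trans ?_
    have := pp_anti ξ a n0 p hp hξ (hA.trans ha)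
    gcongr
  · obtain ⟨e, rfl⟩ := Nat.exists_eq_add_of_le hpq
    have := pair_bound (θ := θ) h ξ A a b q e hξ hA ha hab
    have e1 : q + e + 1 = q + 1 + e := by omega
    have e2 : q - (q + e) + ((q + e) - q) = e := by omega
    rw [e1, e2]
    simp only [mul_comm (gg r θ d (ξ * _ ^ (q + 1 + e)))]
    refine this.trans ?_
    have := pp_anti ξ a n0 q hq hξ (hA.trans ha)
    gcongr

lemma block_sq {r θ : ℕ → ℝ} {d : ℕ} {F : ℝ} (h : Coef r d F) (ξ A a b : ℝ) (n0 H : ℕ) (ω : ℕ → ℕ) (hω : StrictMono ω)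
    (T : Finset ℕ) (hT : T.card ≤ H) (hn0 : ∀ n ∈ T, n0 ≤ ω n)
    (hξ : 0 < ξ) (hA : 1 < A) (ha : A ≤ a) (hab : a ≤ b) :
    ∫ x in a..b, UU r θ d ξ ω T x ^ 2 ≤ H * (160 * F * (2 / (1 - 1 / A)) * (b - a)) + H ^ 2 * (32 * d ^ 2 * pp ξ n0 a) := by
  have hA0 : 0 < A := by linarith
  have hpa := pp_pos n0 hξ (by linarith : 0 < a)
  have hρ : 1 / A < 1 := by rw [div_lt_one hA0]; exact hA
  have hρ0 : 0 ≤ 1 / A := by positivity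
  have hF := h.Fnn
  have hTr : (T.card : ℝ) ≤ H := by exact_mod_cast hT
  have e : ∫ x in a..b, UU r θ d ξ ω T x ^ 2 = ∑ m ∈ T, ∑ n ∈ T, ∫ x in a..b, gg r θ d (ξ * x ^ (ω m+1)) * gg r θ d (ξ * x ^ (ω n+1)) := by
    simp only [UU, pow_two, Finset.sum_mul_sum]
    rw [intervalIntegral.integral_finsetSum (fun _ _ => Continuous.intervalIntegrable (by fun_prop) _ _)]
    refine Finset.sum_congr rfl fun j _ => ?_
    rw [intervalIntegral.integral_finsetSum (fun _ _ => Continuous.intervalIntegrable (by fun_prop) _ _)]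
  rw [e]
  have h1 : ∀ m ∈ T, ∑ n ∈ T, ∫ x in a..b, gg r θ d (ξ * x ^ (ω m+1)) * gg r θ d (ξ * x ^ (ω n+1)) ≤
      160 * F * (2 / (1 - 1 / A)) * (b - a) + H * (32 * d ^ 2 * pp ξ n0 a) := by
    intro m hm
    refine (Finset.sum_le_sum fun n hn => pair_bound' (θ := θ) h ξ A a b n0 (ω m) (ω n) (hn0 m hm) (hn0 n hn) hξ hA.le ha hab).trans ?_
    rw [Finset.sum_add_distrib, Finset.sum_const, nsmul_eq_mul, ← Finset.sum_mul, ← Finset.mul_sum]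
    have := geom_two (1 / A) hρ0 hρ T ω hω m
    have : 0 ≤ b - a := by linarith
    gcongr
  refine (Finset.sum_le_sum h1).trans ?_
  rw [Finset.sum_const, nsmul_eq_mul]
  have h2 : 0 ≤ 160 * F * (2 / (1 - 1 / A)) * (b - a) + H * (32 * d ^ 2 * pp ξ n0 a) := by
    have : 0 ≤ b - a := by linarith
    have : 0 < 1 - 1 / A := by linarith
    positivity
  calc _ ≤ (H:ℝ) * (160 * F * (2 / (1 - 1 / A)) * (b - a) + H * (32 * d ^ 2 * pp ξ n0 a)) := by gcongr
    _ = _ := by ring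

lemma block_mean {r θ : ℕ → ℝ} {d : ℕ} {F : ℝ} (h : Coef r d F) (ξ a b : ℝ) (n0 H : ℕ) (ω : ℕ → ℕ)
    (T : Finset ℕ) (hT : T.card ≤ H) (hn0 : ∀ n ∈ T, n0 ≤ ω n)
    (hξ : 0 < ξ) (ha : 1 ≤ a) (hab : a ≤ b) :
    ∫ x in a..b, UU r θ d ξ ω T x ≤ H * (d * (16 * pp ξ n0 a)) := by
  have hpa := pp_pos n0 hξ (by linarith : 0 < a)
  simp only [UU, gg]
  rw [intervalIntegral.integral_finsetSum (fun _ _ => Continuous.intervalIntegrable (by fun_prop) _ _)]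
  have h1 : ∀ n ∈ T, ∫ x in a..b, ∑ j ∈ Finset.Icc 1 d, r j * Real.cos (2 * Real.pi * j * (ξ * x ^ (ω n + 1)) + θ j) ≤ d * (16 * pp ξ n0 a) := by
    intro n hn
    rw [intervalIntegral.integral_finsetSum (fun _ _ => Continuous.intervalIntegrable (by fun_prop) _ _)]
    have : ∀ j ∈ Finset.Icc 1 d, ∫ x in a..b, r j * Real.cos (2 * Real.pi * j * (ξ * x ^ (ω n + 1)) + θ j) ≤ 16 * pp ξ n0 a := by
      intro j hj
      rw [intervalIntegral.integral_const_mul]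
      have hj1 : (1:ℝ) ≤ j := by exact_mod_cast (Finset.mem_Icc.1 hj).1
      have h2 := (le_abs_self _).trans (osc_single ξ a b (ω n) j (θ j) hj1 hξ (by linarith) hab)
      have h3 := pp_anti ξ a n0 (ω n) (hn0 n hn) hξ ha
      calc _ ≤ r j * (4 * pp ξ n0 a) := mul_le_mul_of_nonneg_left (by linarith) (h.nonneg j)
        _ ≤ 4 * (4 * pp ξ n0 a) := by gcongr; exact h.le_four hj
        _ = _ := by ring
    refine (Finset.sum_le_sum this).trans ?_
    simp
  refine (Finset.sum_le_sum h1).trans ?_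
  rw [Finset.sum_const, nsmul_eq_mul]
  gcongr

lemma exp_le_quad (t : ℝ) (h : |t| ≤ 1) : Real.exp t ≤ 1 + t + t ^ 2 := by
  have := (abs_le.1 (Real.abs_exp_sub_one_sub_id_le h)).2
  linarith

lemma block_exp {r θ : ℕ → ℝ} {d : ℕ} {F : ℝ} (h : Coef r d F) (ξ A a b : ℝ) (n0 H : ℕ) (ω : ℕ → ℕ) (hω : StrictMono ω)
    (T : Finset ℕ) (hT : T.card ≤ H) (hn0 : ∀ n ∈ T, n0 ≤ ω n)
    (hξ : 0 < ξ) (hA : 1 < A) (ha : A ≤ a) (hab : a ≤ b) (τ : ℝ) (hτ : 0 < τ)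
    (hU : ∀ x, |2 * τ * UU r θ d ξ ω T x| ≤ 1) :
    ∫ x in a..b, Real.exp (2 * τ * UU r θ d ξ ω T x) ≤
      (b - a) + 2 * τ * (H * (d * (16 * pp ξ n0 a))) +
       4 * τ ^ 2 * (H * (160 * F * (2 / (1 - 1 / A)) * (b - a)) + H ^ 2 * (32 * d ^ 2 * pp ξ n0 a)) := by
  have c := continuous_UU r θ d ξ ω T
  have h1 : ∫ x in a..b, Real.exp (2 * τ * UU r θ d ξ ω T x) ≤
      ∫ x in a..b, (1 + 2 * τ * UU r θ d ξ ω T x + 4 * τ ^ 2 * UU r θ d ξ ω T x ^ 2) := by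
    apply intervalIntegral.integral_mono_on hab (Continuous.intervalIntegrable (by fun_prop) _ _) (Continuous.intervalIntegrable (by fun_prop) _ _)
    intro x _
    refine (exp_le_quad _ (hU x)).trans (le_of_eq (by ring))
  rw [intervalIntegral.integral_add (Continuous.intervalIntegrable (by fun_prop) _ _) (Continuous.intervalIntegrable (by fun_prop) _ _),
    intervalIntegral.integral_add (Continuous.intervalIntegrable (by fun_prop) _ _) (Continuous.intervalIntegrable (by fun_prop) _ _),
    intervalIntegral.integral_const_mul, intervalIntegral.integral_const_mul] at h1
  simp only [intervalIntegral.integral_const, smul_eq_mul, mul_one] at h1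
  have h2 := block_mean (θ := θ) h ξ a b n0 H ω T hT hn0 hξ (by linarith) hab
  have h3 := block_sq (θ := θ) h ξ A a b n0 H ω hω T hT hn0 hξ hA ha hab
  have h4 := mul_le_mul_of_nonneg_left h2 (by positivity : 0 ≤ 2 * τ)
  have h5 := mul_le_mul_of_nonneg_left h3 (by positivity : 0 ≤ 4 * τ ^ 2)
  linarith

lemma gg_bound {r θ : ℕ → ℝ} {d : ℕ} {F : ℝ} (h : Coef r d F) (y : ℝ) : |gg r θ d y| ≤ 4 * (1 + Real.log d) := by
  unfold gg
  refine (Finset.abs_sum_le_sum_abs _ _).trans ?_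
  have h1 : ∀ j ∈ Finset.Icc 1 d, |r j * Real.cos (2 * Real.pi * j * y + θ j)| ≤ 4 * (j:ℝ)⁻¹ := by
    intro j hj
    rw [abs_mul, abs_of_nonneg (h.nonneg j)]
    calc _ ≤ r j * 1 := mul_le_mul_of_nonneg_left (Real.abs_cos_le_one _) (h.nonneg j)
      _ ≤ 4 * (j:ℝ)⁻¹ := by rw [mul_one, ← div_eq_mul_inv]; exact h.le4 j (Finset.mem_Icc.1 hj).1
  refine (Finset.sum_le_sum h1).trans ?_
  rw [← Finset.mul_sum]
  gcongr
  have := harmonic_le_one_add_log d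
  rw [harmonic_eq_sum_Icc] at this
  push_cast at this
  exact this

lemma gg_lip {r θ : ℕ → ℝ} {d : ℕ} {F : ℝ} (h : Coef r d F) (y z : ℝ) : |gg r θ d y - gg r θ d z| ≤ 26 * d * |y - z| := by
  unfold gg
  rw [← Finset.sum_sub_distrib]
  refine (Finset.abs_sum_le_sum_abs _ _).trans ?_
  have h1 : ∀ j ∈ Finset.Icc 1 d, |r j * Real.cos (2 * Real.pi * j * y + θ j) - r j * Real.cos (2 * Real.pi * j * z + θ j)| ≤ 26 * |y - z| := by
    intro j hj
    have hj1 : (0:ℝ) < j := by exact_mod_cast (Finset.mem_Icc.1 hj).1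
    have hr := h.le4 j (Finset.mem_Icc.1 hj).1
    rw [← mul_sub, abs_mul, abs_of_nonneg (h.nonneg j)]
    have hc : |Real.cos (2 * Real.pi * j * y + θ j) - Real.cos (2 * Real.pi * j * z + θ j)| ≤ |(2 * Real.pi * j * y + θ j) - (2 * Real.pi * j * z + θ j)| := by
      have := Real.lipschitzWith_cos.dist_le_mul (2 * Real.pi * j * y + θ j) (2 * Real.pi * j * z + θ j)
      simpa [Real.dist_eq] using this
    have e : (2 * Real.pi * j * y + θ j) - (2 * Real.pi * j * z + θ j) = (2 * Real.pi * j) * (y - z) := by ring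
    rw [e, abs_mul (2 * Real.pi * j), abs_of_pos (by positivity : 0 < 2 * Real.pi * (j:ℝ))] at hc
    calc _ ≤ (4 / j) * (2 * Real.pi * j * |y - z|) := mul_le_mul hr hc (abs_nonneg _) (by positivity)
      _ = 8 * Real.pi * |y - z| := by field_simp; ring
      _ ≤ 26 * |y - z| := by
        gcongr
        have := Real.pi_lt_d2
        linarith
  refine (Finset.sum_le_sum h1).trans ?_
  simp only [Finset.sum_const, Nat.card_Icc, Nat.add_sub_cancel, nsmul_eq_mul]
  exact le_of_eq (by ring)

lemma bisect (A B : ℝ) (G1 G2 : ℝ → ℝ) (c1 : Continuous G1) (c2 : Continuous G2) (L : ℝ → ℝ)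
    (hL : ∀ x, A ≤ x → x ≤ B → 0 < L x) (hanti : ∀ x y, A ≤ x → x ≤ y → y ≤ B → L y ≤ L x)
    (h : ∀ a b, A ≤ a → a ≤ b → b ≤ B → L a ≤ b - a → b - a ≤ 2 * L a → ∫ x in a..b, G1 x ≤ ∫ x in a..b, G2 x) :
    ∀ a b, A ≤ a → a ≤ b → b ≤ B → L a ≤ b - a → ∫ x in a..b, G1 x ≤ ∫ x in a..b, G2 x := by
  have key : ∀ n : ℕ, ∀ a b, A ≤ a → a ≤ b → b ≤ B → L a ≤ b - a → b - a ≤ 2 ^ n * (2 * L B) →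
      ∫ x in a..b, G1 x ≤ ∫ x in a..b, G2 x := by
    intro n
    induction n with
    | zero =>
      intro a b h1 h2 h3 h4 h5
      apply h a b h1 h2 h3 h4
      have := hanti a B h1 (h2.trans h3) le_rfl
      simp at h5
      linarith
    | succ n ih =>
      intro a b h1 h2 h3 h4 h5
      by_cases h6 : b - a ≤ 2 * L a
      · exact h a b h1 h2 h3 h4 h6
      · push Not at h6
        have hm1 : a ≤ (a + b) / 2 := by linarith
        have hm2 : (a + b) / 2 ≤ b := by linarith
        have h7 := hanti a ((a + b) / 2) h1 hm1 (by linarith)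
        rw [pow_succ] at h5
        have i1 := ih a ((a+b)/2) h1 hm1 (by linarith) (by linarith) (by linarith)
        have i2 := ih ((a+b)/2) b (by linarith) hm2 h3 (by linarith) (by linarith)
        rw [← intervalIntegral.integral_add_adjacent_intervals (c1.intervalIntegrable a ((a+b)/2)) (c1.intervalIntegrable ((a+b)/2) b),
          ← intervalIntegral.integral_add_adjacent_intervals (c2.intervalIntegrable a ((a+b)/2)) (c2.intervalIntegrable ((a+b)/2) b)]
        exact add_le_add i1 i2
  intro a b h1 h2 h3 h4
  have hB := hL B (h1.trans (h2.trans h3)) le_rfl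
  obtain ⟨n, hn⟩ := pow_unbounded_of_one_lt ((b - a) / (2 * L B)) (by norm_num : (1:ℝ) < 2)
  apply key n a b h1 h2 h3 h4
  rw [div_lt_iff₀ (by positivity)] at hn
  exact hn.le

lemma chain (A B : ℝ) (V : ℕ → ℝ → ℝ) (cV : ∀ i, Continuous (V i)) (L : ℕ → ℝ → ℝ) (Q1 ε : ℝ) (hQ : 0 ≤ Q1)
    (hL : ∀ i x, A ≤ x → x ≤ B → 0 < L i x) (hanti : ∀ i x y, A ≤ x → x ≤ y → y ≤ B → L i y ≤ L i x)
    (hL2 : ∀ i x, A ≤ x → x ≤ B → L (i+2) x ≤ L i x)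
    (h1 : ∀ i a b, 1 ≤ i → A ≤ a → a ≤ b → b ≤ B → L i a ≤ b - a → ∫ x in a..b, Real.exp (V i x) ≤ Q1 * (b - a))
    (h2 : ∀ i a b, 1 ≤ i → A ≤ a → a ≤ b → b ≤ B → b - a ≤ 2 * L (i+2) a → ∀ x ∈ Set.Icc a b, |V i x - V i a| ≤ ε) :
    ∀ r i a b, 1 ≤ i → A ≤ a → a ≤ b → b ≤ B → L i a ≤ b - a →
      ∫ x in a..b, Real.exp (∑ l ∈ Finset.range r, V (i + 2 * l) x) ≤ (Real.exp (2 * ε) * Q1) ^ r * (b - a) := by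
  intro r
  induction r with
  | zero => intro i a b _ _ _ _ _; simp
  | succ r ih =>
    intro i a b hi ha hab hb hl
    set R : ℝ → ℝ := fun x => ∑ l ∈ Finset.range r, V (i + 2 + 2 * l) x with hR
    have cR : Continuous R := continuous_finsetSum _ fun l _ => cV _
    have hVi := cV i
    set Q := (Real.exp (2 * ε) * Q1) ^ r with hQr
    have hQ0 : 0 ≤ Q := by positivity
    have e : ∀ x, ∑ l ∈ Finset.range (r+1), V (i + 2 * l) x = V i x + R x := by
      intro x
      rw [Finset.sum_range_succ', add_comm]
      congr 1
      apply Finset.sum_congr rfl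
      intro l _
      congr 1; ring
    simp only [e]
    have hb' := bisect A B (fun x => Real.exp (V i x + R x)) (fun x => Real.exp (2 * ε) * Q * Real.exp (V i x))
      (by fun_prop) (by fun_prop) (L (i+2)) (hL (i+2)) (hanti (i+2)) ?_ a b ha hab hb ((hL2 i a ha (hab.trans hb)).trans hl)
    · refine hb'.trans ?_
      rw [intervalIntegral.integral_const_mul]
      have := mul_le_mul_of_nonneg_left (h1 i a b hi ha hab hb hl) (by positivity : 0 ≤ Real.exp (2 * ε) * Q)
      refine this.trans (le_of_eq ?_)
      rw [pow_succ]; ring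
    · intro a b ha hab hb hl1 hl2
      have ho := h2 i a b hi ha hab hb hl2
      have s1 : ∫ x in a..b, Real.exp (V i x + R x) ≤ ∫ x in a..b, Real.exp (V i a + ε) * Real.exp (R x) := by
        apply intervalIntegral.integral_mono_on hab (Continuous.intervalIntegrable (by fun_prop) _ _) (Continuous.intervalIntegrable (by fun_prop) _ _)
        intro x hx
        rw [← Real.exp_add]
        apply Real.exp_le_exp.2
        have := (abs_le.1 (ho x hx)).2
        linarith
      have s2 : ∫ x in a..b, Real.exp (V i a - ε) ≤ ∫ x in a..b, Real.exp (V i x) := by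
        apply intervalIntegral.integral_mono_on hab (by simp) (Continuous.intervalIntegrable (by fun_prop) _ _)
        intro x hx
        apply Real.exp_le_exp.2
        have := (abs_le.1 (ho x hx)).1
        linarith
      rw [intervalIntegral.integral_const_mul] at s1
      rw [intervalIntegral.integral_const, smul_eq_mul] at s2
      rw [intervalIntegral.integral_const_mul]
      have s3 := ih (i+2) a b (by omega) ha hab hb hl1
      calc _ ≤ _ := s1
        _ ≤ Real.exp (V i a + ε) * (Q * (b - a)) := by gcongr
        _ = Real.exp (2 * ε) * Q * ((b - a) * Real.exp (V i a - ε)) := by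
            have : V i a + ε = 2 * ε + (V i a - ε) := by ring
            rw [this, Real.exp_add]; ring
        _ ≤ _ := by gcongr

lemma pow_diff (ξ A D a b : ℝ) (w n1 H : ℕ) (hξ : 0 < ξ) (hA : 1 < A) (hD : 0 < D) (ha : A ≤ a) (hab : a ≤ b)
    (hw : w + H ≤ n1) (hDA : 2 * D ≤ ξ * A ^ H) (hJ : b - a ≤ 2 * (D * pp ξ n1 a)) (x : ℝ) (hx : x ∈ Set.Icc a b) :
    |ξ * x ^ (w+1) - ξ * a ^ (w+1)| ≤ 6 * D * (1 / A) ^ H := by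
  have hA0 : 0 < A := by linarith
  have ha0 : 0 < a := by linarith
  have hx0 : 0 ≤ x := by linarith [hx.1]
  obtain ⟨k, rfl⟩ := Nat.exists_eq_add_of_le hw
  have hmv : x ^ (w+1) - a ^ (w+1) ≤ (w+1) * b ^ w * (b - a) := by
    have hg := Convex.norm_image_sub_le_of_norm_hasDerivWithin_le (f := fun y : ℝ => y ^ (w+1)) (f' := fun y => ((w+1 : ℕ):ℝ) * y ^ w)
      (C := (w+1) * b ^ w) (s := Set.Icc a b) (x := a) (y := x) (fun y _ => by simpa using (hasDerivAt_pow (w+1) y).hasDerivWithinAt) ?_ (convex_Icc a b)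
      ⟨le_rfl, hab⟩ hx
    · have h1 := (le_abs_self _).trans hg
      refine h1.trans ?_
      rw [Real.norm_eq_abs, abs_of_nonneg (by linarith [hx.1])]
      have : 0 ≤ b := by linarith
      have := hx.2
      gcongr
    · intro y hy
      have hy0 : 0 ≤ y := by linarith [hy.1]
      rw [Real.norm_eq_abs, abs_of_nonneg (by positivity)]
      push_cast
      have := hy.2
      gcongr
  have hmono : a ^ (w+1) ≤ x ^ (w+1) := pow_le_pow_left₀ ha0.le hx.1 _
  rw [← mul_sub, abs_mul, abs_of_pos hξ, abs_of_nonneg (by linarith)]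
  have haH : A ^ H ≤ a ^ H := pow_le_pow_left₀ hA0.le ha H
  have hak : 1 ≤ a ^ k := one_le_pow₀ (by linarith)
  have haw : 1 ≤ a ^ w := one_le_pow₀ (by linarith)
  -- length bound
  have hpp : (w+1) * (D * pp ξ (w + H + k) a) ≤ D / (ξ * a ^ w * A ^ H) := by
    unfold pp
    push_cast
    have e : (w+1 : ℝ) * (D * (1 / (ξ * ((w:ℝ) + H + k + 1) * a ^ (w + H + k)))) = D * (w+1) / (ξ * ((w:ℝ) + H + k + 1) * a ^ (w + H + k)) := by ring
    rw [e, div_le_div_iff₀ (by positivity) (by positivity), pow_add, pow_add]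
    have t1 : (w + 1 : ℝ) ≤ (w:ℝ) + H + k + 1 := by linarith [Nat.cast_nonneg (α := ℝ) H, Nat.cast_nonneg (α := ℝ) k]
    have t2 : A ^ H ≤ a ^ H * a ^ k := by nlinarith [pow_pos hA0 H]
    calc D * (w+1) * (ξ * a ^ w * A ^ H) ≤ D * ((w:ℝ) + H + k + 1) * (ξ * a ^ w * (a ^ H * a ^ k)) := by gcongr
      _ = _ := by ring
  have hlen : (w+1) * (b - a) ≤ 2 * (D / (ξ * a ^ w * A ^ H)) := by
    have : (w+1) * (b - a) ≤ (w+1) * (2 * (D * pp ξ (w + H + k) a)) := by gcongr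
    linarith
  have hlen1 : (w+1) * (b - a) ≤ 1 := by
    refine hlen.trans ?_
    rw [← mul_div_assoc, div_le_one (by positivity)]
    refine hDA.trans ?_
    have : 0 < A ^ H := by positivity
    have := mul_le_mul_of_nonneg_left haw (by positivity : 0 ≤ ξ * A ^ H)
    linarith
  have hbw : b ^ w ≤ 3 * a ^ w := by
    have t1 : b ≤ a * Real.exp (b - a) := by
      have := Real.add_one_le_exp (b - a)
      nlinarith
    calc b ^ w ≤ (a * Real.exp (b - a)) ^ w := pow_le_pow_left₀ (by linarith) t1 w
      _ = a ^ w * Real.exp (w * (b - a)) := by rw [mul_pow, ← Real.exp_nat_mul]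
      _ ≤ a ^ w * 3 := by
        gcongr
        have : Real.exp (w * (b - a)) ≤ Real.exp 1 := Real.exp_le_exp.2 (by linarith)
        linarith [Real.exp_one_lt_d9]
      _ = _ := by ring
  calc ξ * (x ^ (w+1) - a ^ (w+1)) ≤ ξ * ((w+1) * b ^ w * (b - a)) := by gcongr
    _ = ξ * b ^ w * ((w+1) * (b - a)) := by ring
    _ ≤ ξ * (3 * a ^ w) * (2 * (D / (ξ * a ^ w * A ^ H))) := by
        have : 0 ≤ (w+1) * (b - a) := mul_nonneg (by positivity) (by linarith)
        gcongr
    _ = 6 * D * (1 / A) ^ H := by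
        rw [one_div_pow]; field_simp; ring

lemma UU_diff {r θ : ℕ → ℝ} {d : ℕ} {F : ℝ} (h : Coef r d F) (ξ A D a b : ℝ) (n1 H : ℕ) (ω : ℕ → ℕ) (T : Finset ℕ)
    (hT : T.card ≤ H) (hξ : 0 < ξ) (hA : 1 < A) (hD : 0 < D) (ha : A ≤ a) (hab : a ≤ b)
    (hw : ∀ n ∈ T, ω n + H ≤ n1) (hDA : 2 * D ≤ ξ * A ^ H) (hJ : b - a ≤ 2 * (D * pp ξ n1 a)) (x : ℝ) (hx : x ∈ Set.Icc a b) :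
    |UU r θ d ξ ω T x - UU r θ d ξ ω T a| ≤ H * (26 * d * (6 * D * (1 / A) ^ H)) := by
  unfold UU
  rw [← Finset.sum_sub_distrib]
  refine (Finset.abs_sum_le_sum_abs _ _).trans ?_
  have h1 : ∀ n ∈ T, |gg r θ d (ξ * x ^ (ω n + 1)) - gg r θ d (ξ * a ^ (ω n + 1))| ≤ 26 * d * (6 * D * (1 / A) ^ H) := by
    intro n hn
    refine (gg_lip h _ _).trans ?_
    gcongr
    exact pow_diff ξ A D a b (ω n) n1 H hξ hA hD ha hab (hw n hn) hDA hJ x hx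
  refine (Finset.sum_le_sum h1).trans ?_
  rw [Finset.sum_const, nsmul_eq_mul]
  have : (0:ℝ) < A := by linarith
  gcongr

lemma UU_bound {r θ : ℕ → ℝ} {d : ℕ} {F : ℝ} (h : Coef r d F) (ξ : ℝ) (H : ℕ) (ω : ℕ → ℕ) (T : Finset ℕ)
    (hT : T.card ≤ H) (x : ℝ) : |UU r θ d ξ ω T x| ≤ H * (4 * (1 + Real.log d)) := by
  unfold UU
  refine (Finset.abs_sum_le_sum_abs _ _).trans ?_
  refine (Finset.sum_le_sum fun n _ => gg_bound h _).trans ?_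
  rw [Finset.sum_const, nsmul_eq_mul]
  have : 0 ≤ Real.log d := Real.log_natCast_nonneg d
  gcongr

lemma sum_split (u : ℕ → ℝ) (r : ℕ) : ∑ i ∈ Finset.range (2 * r + 1), u i =
    u 0 + ∑ l ∈ Finset.range r, u (1 + 2 * l) + ∑ l ∈ Finset.range r, u (2 + 2 * l) := by
  induction r with
  | zero => simp
  | succ r ih =>
    have : 2 * (r + 1) + 1 = (2 * r + 1) + 1 + 1 := by ring
    rw [this, Finset.sum_range_succ, Finset.sum_range_succ, ih, Finset.sum_range_succ (n := r), Finset.sum_range_succ (n := r)]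
    have e1 : 2 * r + 1 = 1 + 2 * r := by ring
    have e2 : 2 * r + 2 = 2 + 2 * r := by ring
    have e3 : 2 * r + 1 + 1 = 2 + 2 * r := by ring
    simp only [e3, e2, e1]; ring

lemma strictMono_add (ω : ℕ → ℕ) (hω : StrictMono ω) (n k : ℕ) : ω n + k ≤ ω (n + k) := by
  induction k with
  | zero => simp
  | succ k ih =>
    have := hω (show n + k < n + (k + 1) by omega)
    omega

lemma main_est {r θ : ℕ → ℝ} {N : ℕ} {F : ℝ} (h : Coef r (N ^ 38) F) (ξ A B : ℝ) (hξ : 0 < ξ) (hA : 1 < A) (hAB : B - A = 1)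
    (ω : ℕ → ℕ) (hω : StrictMono ω) (H : ℕ) (hH1 : 1 ≤ H) (hHN : H ≤ N) (τ : ℝ) (hτ : 0 < τ) (hτ1 : τ ≤ 1)
    (hU : 2 * τ * (H * (4 * (1 + Real.log ((N ^ 38 : ℕ) : ℝ)))) ≤ 1)
    (hE3 : 2 * (N:ℝ) ^ 80 ≤ ξ * A ^ H) (hE4 : 156 * (N:ℝ) ^ 120 ≤ A ^ H) :
    ∫ x in A..B, Real.exp (τ * ∑ n ∈ Finset.range N, gg r θ (N ^ 38) (ξ * x ^ (ω n + 1))) ≤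
      Real.exp 329 * Real.exp (τ ^ 2 * (2 * (640 * (2 / (1 - 1 / A)))) * F * N) := by
  have hA0 : 0 < A := by linarith
  have hABle : A ≤ B := by linarith
  have hN1 : 1 ≤ N := hH1.trans hHN
  have hNr : (1:ℝ) ≤ N := by exact_mod_cast hN1
  have hHr : (1:ℝ) ≤ H := by exact_mod_cast hH1
  have hHNr : (H:ℝ) ≤ N := by exact_mod_cast hHN
  have hF := h.Fnn
  have hρ : 0 < 1 - 1 / A := by
    have : 1 / A < 1 := by rw [div_lt_one hA0]; exact hA
    linarith
  set KA : ℝ := 640 * (2 / (1 - 1 / A)) with hKA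
  have hKA0 : 0 < KA := by positivity
  set d := N ^ 38 with hd
  have hdr : (d:ℝ) = (N:ℝ) ^ 38 := by rw [hd]; push_cast; ring
  set D : ℝ := (N:ℝ) ^ 80 with hD
  have hD0 : 0 < D := by positivity
  set T : ℕ → Finset ℕ := fun i => (Finset.range N).filter (fun n => n / H = i) with hT
  set U : ℕ → ℝ → ℝ := fun i => UU r θ d ξ ω (T i) with hUdef
  have hTm : ∀ i, ∀ n ∈ T i, i * H ≤ n ∧ n < (i + 1) * H := by
    intro i n hn
    have h1 := (Finset.mem_filter.1 hn).2
    rw [← h1]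
    exact ⟨Nat.div_mul_le_self n H, by rw [mul_comm]; exact Nat.lt_mul_div_succ n hH1⟩
  have hTc : ∀ i, (T i).card ≤ H := by
    intro i
    have : T i ⊆ Finset.Ico (i * H) ((i+1) * H) := fun n hn => Finset.mem_Ico.2 (hTm i n hn)
    refine (Finset.card_le_card this).trans ?_
    rw [Nat.card_Ico, add_mul, one_mul]; omega
  set n0 : ℕ → ℕ := fun i => ω (i * H) with hn0
  have hn0T : ∀ i, ∀ n ∈ T i, n0 i ≤ ω n := fun i n hn => hω.monotone (hTm i n hn).1
  have hn0T2 : ∀ i, ∀ n ∈ T i, ω n + H ≤ n0 (i + 2) := by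
    intro i n hn
    refine (strictMono_add ω hω n H).trans (hω.monotone ?_)
    have := (hTm i n hn).2
    have e : (i + 2) * H = (i + 1) * H + H := by ring
    omega
  have hUb : ∀ i x, |2 * τ * U i x| ≤ 1 := by
    intro i x
    rw [abs_mul, abs_of_pos (by positivity : 0 < 2 * τ)]
    refine le_trans ?_ hU
    gcongr
    exact UU_bound h ξ H ω (T i) (hTc i) x
  set V : ℕ → ℝ → ℝ := fun i x => 2 * τ * U i x with hV
  have cU : ∀ i, Continuous (U i) := fun i => continuous_UU _ _ _ _ _ _
  have cV : ∀ i, Continuous (V i) := fun i => continuous_const.mul (cU i)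
  set L : ℕ → ℝ → ℝ := fun i x => D * pp ξ (n0 i) x with hL
  set Q1 : ℝ := Real.exp (160 / N + τ ^ 2 * (H * F * KA)) with hQ1
  have hblock : ∀ i a b, 1 ≤ i → A ≤ a → a ≤ b → b ≤ B → L i a ≤ b - a → ∫ x in a..b, Real.exp (V i x) ≤ Q1 * (b - a) := by
    intro i a b hi ha hab hb hl
    have hbe := block_exp (θ := θ) h ξ A a b (n0 i) H ω hω (T i) (hTc i) (hn0T i) hξ hA ha hab τ hτ (hUb i)
    refine hbe.trans ?_
    have hba : 0 ≤ b - a := by linarith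
    set P := pp ξ (n0 i) a with hP
    have hP0 : 0 < P := pp_pos _ hξ (by linarith)
    have hPd : (N:ℝ) ^ 80 * P ≤ b - a := hl
    have t1 : 2 * τ * (H * (d * (16 * P))) ≤ 32 / N * (b - a) := by
      have : 2 * τ * (H * (d * (16 * P))) ≤ 2 * 1 * (N * (d * (16 * P))) := by gcongr
      refine this.trans ?_
      rw [hdr, div_mul_eq_mul_div, le_div_iff₀ (by positivity)]
      calc 2 * 1 * ((N:ℝ) * (N ^ 38 * (16 * P))) * N = 32 * (N ^ 40 * P) := by ring
        _ ≤ 32 * (N ^ 80 * P) := by gcongr <;> norm_num [hNr]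
        _ ≤ _ := by linarith
    have t2 : 4 * τ ^ 2 * ((H:ℝ) ^ 2 * (32 * d ^ 2 * P)) ≤ 128 / N * (b - a) := by
      have : 4 * τ ^ 2 * ((H:ℝ) ^ 2 * (32 * d ^ 2 * P)) ≤ 4 * 1 ^ 2 * ((N:ℝ) ^ 2 * (32 * d ^ 2 * P)) := by gcongr
      refine this.trans ?_
      rw [hdr, div_mul_eq_mul_div, le_div_iff₀ (by positivity)]
      calc 4 * 1 ^ 2 * ((N:ℝ) ^ 2 * (32 * (N ^ 38) ^ 2 * P)) * N = 128 * (N ^ 79 * P) := by ring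
        _ ≤ 128 * (N ^ 80 * P) := by gcongr <;> norm_num [hNr]
        _ ≤ _ := by linarith
    have t3 : 4 * τ ^ 2 * (H * (160 * F * (2 / (1 - 1 / A)) * (b - a))) = τ ^ 2 * (H * F * KA) * (b - a) := by
      rw [hKA]; ring
    have t4 := Real.add_one_le_exp (160 / N + τ ^ 2 * (H * F * KA))
    have t5 := mul_le_mul_of_nonneg_right t4 hba
    have e160 : (160:ℝ) / N = 32 / N + 128 / N := by ring
    rw [e160] at t5
    rw [hQ1, e160]
    refine le_trans ?_ t5
    rw [mul_add (4 * τ ^ 2), t3]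
    linarith
  have hosc : ∀ i a b, 1 ≤ i → A ≤ a → a ≤ b → b ≤ B → b - a ≤ 2 * L (i+2) a → ∀ x ∈ Set.Icc a b, |V i x - V i a| ≤ 2 / N := by
    intro i a b hi ha hab hb hl x hx
    have := UU_diff (θ := θ) h ξ A D a b (n0 (i+2)) H ω (T i) (hTc i) hξ hA hD0 ha hab (hn0T2 i) hE3 hl x hx
    have e : V i x - V i a = 2 * τ * (UU r θ d ξ ω (T i) x - UU r θ d ξ ω (T i) a) := by
      simp only [hV, hUdef]; ring
    rw [e, abs_mul, abs_of_pos (by positivity : 0 < 2 * τ)]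
    have hη : (H:ℝ) * (26 * d * (6 * D * (1 / A) ^ H)) ≤ 1 / N := by
      rw [hdr, hD, one_div_pow, le_div_iff₀ (by positivity)]
      calc (H:ℝ) * (26 * N ^ 38 * (6 * N ^ 80 * (1 / A ^ H))) * N ≤ (N:ℝ) * (26 * N ^ 38 * (6 * N ^ 80 * (1 / A ^ H))) * N := by gcongr
        _ = 156 * N ^ 120 / A ^ H := by ring
        _ ≤ 1 := by rw [div_le_one (by positivity)]; exact hE4
    calc _ ≤ 2 * 1 * (1 / (N:ℝ)) := by
          gcongr
          exact this.trans hη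
      _ = _ := by ring
  have hch := chain A B V cV L Q1 (2 / N) (Real.exp_pos _).le
    (fun i x hx _ => mul_pos hD0 (pp_pos _ hξ (by linarith)))
    (fun i x y hx hxy _ => by
      simp only [hL]
      apply mul_le_mul_of_nonneg_left _ hD0.le
      unfold pp
      have : 0 < x := by linarith
      gcongr)
    (fun i x hx _ => by
      simp only [hL]
      apply mul_le_mul_of_nonneg_left _ hD0.le
      apply pp_anti _ _ _ _ _ hξ (by linarith)
      apply hω.monotone
      gcongr; omega) hblock hosc
  set R := N / H + 1 with hR
  have hstart : ∀ i, 1 ≤ i → L i A ≤ B - A := by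
    intro i hi
    rw [hAB]
    have hle : H ≤ n0 i := by
      have h1 : H ≤ i * H := Nat.le_mul_of_pos_left H hi
      exact h1.trans hω.le_apply
    have := pp_anti ξ A H (n0 i) hle hξ hA.le
    calc D * pp ξ (n0 i) A ≤ D * pp ξ H A := by gcongr
      _ ≤ 1 := by
        unfold pp
        rw [mul_one_div, div_le_one (by positivity)]
        have h1 : ξ * A ^ H ≤ ξ * (H + 1) * A ^ H := by
          have : 0 < ξ * A ^ H := by positivity
          nlinarith
        linarith
  have hQR : (Real.exp (2 * (2 / N)) * Q1) ^ R ≤ Real.exp (328 + τ ^ 2 * (2 * KA) * F * N) := by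
    rw [hQ1, ← Real.exp_add, ← Real.exp_nat_mul]
    apply Real.exp_le_exp.2
    have hRH : (R:ℝ) * H ≤ 2 * N := by
      have : R * H ≤ 2 * N := by
        rw [hR, add_mul, one_mul]
        have := Nat.div_mul_le_self N H
        omega
      exact_mod_cast this
    have hRN : (R:ℝ) ≤ 2 * N := le_trans (by nlinarith [Nat.cast_nonneg (α := ℝ) R]) hRH
    calc (R:ℝ) * (2 * (2 / N) + (160 / N + τ ^ 2 * (H * F * KA))) = R * (164 / N) + (R * H) * (τ ^ 2 * (F * KA)) := by ring
      _ ≤ (2 * N) * (164 / N) + (2 * N) * (τ ^ 2 * (F * KA)) := by gcongr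
      _ = _ := by field_simp; ring
  have c1 := hch R 1 A B le_rfl le_rfl hABle le_rfl (hstart 1 le_rfl)
  have c2 := hch R 2 A B (by norm_num) le_rfl hABle le_rfl (hstart 2 (by norm_num))
  rw [hAB, mul_one] at c1 c2
  have hsum : ∀ x, τ * ∑ n ∈ Finset.range N, gg r θ d (ξ * x ^ (ω n + 1)) =
      τ * U 0 x + (1/2) * (∑ l ∈ Finset.range R, V (1 + 2 * l) x) + (1/2) * (∑ l ∈ Finset.range R, V (2 + 2 * l) x) := by
    intro x
    have e1 : ∑ n ∈ Finset.range N, gg r θ d (ξ * x ^ (ω n + 1)) = ∑ i ∈ Finset.range (2 * R + 1), U i x := by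
      rw [← Finset.sum_fiberwise_of_maps_to (s := Finset.range N) (t := Finset.range (2 * R + 1)) (g := fun n => n / H)]
      · rfl
      · intro n hn
        have h1 : n / H ≤ N / H := Nat.div_le_div_right (Finset.mem_range.1 hn).le
        rw [Finset.mem_range]; omega
    rw [e1, sum_split (fun i => U i x)]
    simp only [hV, ← Finset.mul_sum]
    ring
  have cS : ∀ k, Continuous fun x => ∑ l ∈ Finset.range R, V (k + 2 * l) x := fun k => continuous_finsetSum _ fun l _ => cV _
  have hpt : ∀ x, Real.exp (τ * ∑ n ∈ Finset.range N, gg r θ d (ξ * x ^ (ω n + 1))) ≤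
      Real.exp 1 * ((1/2) * Real.exp (∑ l ∈ Finset.range R, V (1 + 2 * l) x) + (1/2) * Real.exp (∑ l ∈ Finset.range R, V (2 + 2 * l) x)) := by
    intro x
    rw [hsum x, add_assoc, Real.exp_add]
    set p := ∑ l ∈ Finset.range R, V (1 + 2 * l) x
    set q := ∑ l ∈ Finset.range R, V (2 + 2 * l) x
    have h0 : τ * U 0 x ≤ 1 := by
      have := (abs_le.1 (hUb 0 x)).2
      linarith
    have hpq : Real.exp ((1/2) * p + (1/2) * q) ≤ (1/2) * Real.exp p + (1/2) * Real.exp q := by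
      have e1 : Real.exp p = Real.exp ((1/2) * p) ^ 2 := by rw [← Real.exp_nat_mul]; congr 1; push_cast; ring
      have e2 : Real.exp q = Real.exp ((1/2) * q) ^ 2 := by rw [← Real.exp_nat_mul]; congr 1; push_cast; ring
      rw [Real.exp_add, e1, e2]
      nlinarith [sq_nonneg (Real.exp ((1/2) * p) - Real.exp ((1/2) * q))]
    exact mul_le_mul (Real.exp_le_exp.2 h0) hpq (Real.exp_pos _).le (Real.exp_pos _).le
  have cS1 := cS 1
  have cS2 := cS 2
  have hcU := cU 0
  have hI : ∫ x in A..B, Real.exp (τ * ∑ n ∈ Finset.range N, gg r θ d (ξ * x ^ (ω n + 1))) ≤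
      ∫ x in A..B, Real.exp 1 * ((1/2) * Real.exp (∑ l ∈ Finset.range R, V (1 + 2 * l) x) + (1/2) * Real.exp (∑ l ∈ Finset.range R, V (2 + 2 * l) x)) := by
    apply intervalIntegral.integral_mono_on hABle (Continuous.intervalIntegrable (by fun_prop) _ _) (Continuous.intervalIntegrable (by fun_prop) _ _)
    intro x _; exact hpt x
  rw [intervalIntegral.integral_const_mul, intervalIntegral.integral_add (Continuous.intervalIntegrable (by fun_prop) _ _) (Continuous.intervalIntegrable (by fun_prop) _ _),
    intervalIntegral.integral_const_mul, intervalIntegral.integral_const_mul] at hI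
  refine hI.trans ?_
  have c3 := c1.trans hQR
  have c4 := c2.trans hQR
  calc _ ≤ Real.exp 1 * Real.exp (328 + τ ^ 2 * (2 * KA) * F * N) := by
        apply mul_le_mul_of_nonneg_left _ (Real.exp_pos _).le
        linarith
    _ = _ := by rw [← Real.exp_add, ← Real.exp_add]; congr 1; ring

lemma asymp (ξ A : ℝ) (hξ : 0 < ξ) (hA : 1 < A) : ∃ N₀ : ℕ, ∀ N : ℕ, N₀ ≤ N → ∃ H : ℕ, 1 ≤ H ∧ H ≤ N ∧
    (H:ℝ) * (1 + Real.log ((N ^ 38 : ℕ) : ℝ)) ≤ (N:ℝ) ^ ((1:ℝ)/8) ∧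
    2 * (N:ℝ) ^ 80 ≤ ξ * A ^ H ∧ 156 * (N:ℝ) ^ 120 ≤ A ^ H := by
  have hA0 : 0 < A := by linarith
  have ht : Tendsto (fun N : ℕ => (N:ℝ) ^ ((1:ℝ)/16)) atTop atTop :=
    (tendsto_rpow_atTop (by norm_num)).comp tendsto_natCast_atTop_atTop
  have hH : Tendsto (fun N : ℕ => ⌊(N:ℝ) ^ ((1:ℝ)/16)⌋₊ + 1) atTop atTop :=
    (tendsto_add_atTop_nat 1).comp (tendsto_nat_floor_atTop.comp ht)
  set K : ℝ := 156 + 2 / ξ with hK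
  have hK0 : 0 < K := by positivity
  have h1 : ∀ᶠ N : ℕ in atTop, ((⌊(N:ℝ) ^ ((1:ℝ)/16)⌋₊ + 1 : ℕ) : ℝ) ^ 1920 / A ^ (⌊(N:ℝ) ^ ((1:ℝ)/16)⌋₊ + 1) < 1 / (K * A) := by
    have := (tendsto_pow_const_div_const_pow_of_one_lt 1920 hA).comp hH
    exact this.eventually_lt_const (by positivity)
  have h2 : ∀ᶠ N : ℕ in atTop, Real.log (N:ℝ) ≤ (1/76) * (N:ℝ) ^ ((1:ℝ)/16) := by
    have := (isLittleO_log_rpow_atTop (by norm_num : (0:ℝ) < 1/16)).bound (by norm_num : (0:ℝ) < 1/76)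
    have := tendsto_natCast_atTop_atTop.eventually this
    filter_upwards [this] with N hN
    rw [Real.norm_eq_abs, Real.norm_eq_abs, abs_of_nonneg (by positivity : 0 ≤ (N:ℝ) ^ ((1:ℝ)/16))] at hN
    exact (le_abs_self _).trans hN
  have h3 := ht.eventually_ge_atTop 2
  obtain ⟨N₀, hN₀⟩ := eventually_atTop.1 ((h1.and h2).and (h3.and (eventually_ge_atTop 1)))
  refine ⟨N₀, fun N hN => ?_⟩
  obtain ⟨⟨g1, g2⟩, g3, g4⟩ := hN₀ N hN
  set y := (N:ℝ) ^ ((1:ℝ)/16) with hy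
  have hNr : (1:ℝ) ≤ N := by exact_mod_cast g4
  have hy0 : 0 ≤ y := by linarith
  have hfl : (⌊y⌋₊ : ℝ) ≤ y := Nat.floor_le hy0
  have hyN : y ≤ N := by
    rw [hy]
    calc (N:ℝ) ^ ((1:ℝ)/16) ≤ (N:ℝ) ^ (1:ℝ) := Real.rpow_le_rpow_of_exponent_le hNr (by norm_num)
      _ = N := Real.rpow_one _
  have hy16 : y ^ 16 = N := by
    rw [hy, ← Real.rpow_natCast, ← Real.rpow_mul (by positivity)]; norm_num
  have hyy : y * y = (N:ℝ) ^ ((1:ℝ)/8) := by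
    rw [hy, ← Real.rpow_add (by positivity)]; norm_num
  have hbig : K * (N:ℝ) ^ 120 ≤ A ^ ⌊y⌋₊ := by
    have hlt := (Nat.lt_floor_add_one y).le
    have e1 : (N:ℝ) ^ 120 ≤ ((⌊y⌋₊ + 1 : ℕ) : ℝ) ^ 1920 := by
      rw [← hy16, ← pow_mul]
      push_cast
      gcongr
    rw [div_lt_div_iff₀ (by positivity) (by positivity), pow_succ A] at g1
    have g5 : ((⌊y⌋₊ + 1 : ℕ) : ℝ) ^ 1920 * K ≤ A ^ ⌊y⌋₊ := by
      have : (((⌊y⌋₊ + 1 : ℕ) : ℝ) ^ 1920 * K) * A ≤ A ^ ⌊y⌋₊ * A := by linarith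
      exact le_of_mul_le_mul_right this hA0
    have := mul_le_mul_of_nonneg_right e1 hK0.le
    linarith
  have hNp : 0 < (N:ℝ) ^ 120 := by positivity
  refine ⟨⌊y⌋₊, ?_, ?_, ?_, ?_, ?_⟩
  · exact Nat.one_le_floor_iff _ |>.2 (by linarith)
  · have : (⌊y⌋₊ : ℝ) ≤ N := hfl.trans hyN
    exact_mod_cast this
  · rw [← hyy]
    push_cast
    rw [Real.log_pow]
    have hl : 0 ≤ Real.log (N:ℝ) := Real.log_natCast_nonneg N
    apply mul_le_mul hfl _ (by positivity) hy0
    push_cast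
    linarith
  · have e80 : (N:ℝ) ^ 80 ≤ (N:ℝ) ^ 120 := pow_le_pow_right₀ hNr (by norm_num)
    have : (2 / ξ) * (N:ℝ) ^ 120 ≤ A ^ ⌊y⌋₊ := by
      refine le_trans ?_ hbig
      rw [hK]; nlinarith
    have h5 := mul_le_mul_of_nonneg_left this hξ.le
    have e : ξ * (2 / ξ * (N:ℝ) ^ 120) = 2 * (N:ℝ) ^ 120 := by field_simp
    linarith
  · refine le_trans ?_ hbig
    have : 0 < 2 / ξ := by positivity
    rw [hK]; nlinarith

lemma sum_Icc_shift (F : ℕ → ℝ) (N : ℕ) : ∑ n ∈ Finset.Icc 1 N, F n = ∑ n ∈ Finset.range N, F (n + 1) := by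
  induction N with
  | zero => simp
  | succ N ih => rw [Finset.sum_Icc_succ_top (by omega), Finset.sum_range_succ, ih]

theorem stmt7 (ξ A B : ℝ) (hξ : 0 < ξ) (hA : 1 < A) (hAB : B - A = 1) :
    ∃ (c C : ℝ) (N₀ : ℕ), 1 ≤ c ∧ 0 < C ∧
      ∀ s : ℕ → ℕ, StrictMono s → (∀ n, 1 ≤ n → 1 ≤ s n) →
      ∀ N : ℕ, N₀ ≤ N →
      ∀ f : ℝ → ℝ, (∀ x : ℝ, f (x + 1) = f x) → (∫ x in (0:ℝ)..1, f x) = 0 →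
        eVariationOn f (Set.Icc (0:ℝ) 1) ≤ 2 →
      ∀ M : ℕ, ∀ τ : ℝ, 0 < τ →
        (N : ℝ) ^ (-(1/2) : ℝ) ≤ τ →
        12 * τ * (Nat.ceil ((N : ℝ) ^ ((1:ℝ)/8)) : ℝ) ≤ 1 →
        (∫ x in A..B,
            Real.exp (τ * ∑ n ∈ Finset.Icc 1 N,
              fourierPartial f (N ^ 38) (ξ * x ^ s (M + n)))) ≤
          C * Real.exp (τ ^ 2 * c * fnorm A B f * N) := by
  obtain ⟨N₀, hN₀⟩ := asymp ξ A hξ hA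
  have hA0 : 0 < A := by linarith
  have hρ : 0 < 1 - 1 / A := by
    have : 1 / A < 1 := by rw [div_lt_one hA0]; exact hA
    linarith
  have hρ1 : 1 - 1 / A ≤ 1 := by
    have : 0 < 1 / A := by positivity
    linarith
  refine ⟨2 * (640 * (2 / (1 - 1 / A))), Real.exp 329, N₀, ?_, Real.exp_pos _, ?_⟩
  · have : 1 ≤ 2 / (1 - 1 / A) := by rw [le_div_iff₀ hρ]; linarith
    linarith
  intro s hs hs1 N hN f hper hmean hvar M τ hτ hτN hτH
  obtain ⟨H, hH1, hHN, hHl, hE3, hE4⟩ := hN₀ N hN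
  obtain ⟨r, θ, hr0, hr4, hrsq, hrep⟩ := fourier_repr f hvar
  have hcoef : Coef r (N ^ 38) (fnorm A B f) :=
    ⟨hr0, hr4, Real.sqrt_nonneg _, by rw [fnorm_eq A B hAB f hper]; exact hrsq _⟩
  have hN1 : (1:ℝ) ≤ N := by exact_mod_cast hH1.trans hHN
  have hceil : (N:ℝ) ^ ((1:ℝ)/8) ≤ (Nat.ceil ((N : ℝ) ^ ((1:ℝ)/8)) : ℝ) := Nat.le_ceil _
  have h12 : 12 * τ * (N:ℝ) ^ ((1:ℝ)/8) ≤ 1 := le_trans (by gcongr) hτH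
  have hN8 : (1:ℝ) ≤ (N:ℝ) ^ ((1:ℝ)/8) := Real.one_le_rpow hN1 (by norm_num)
  have hτ1 : τ ≤ 1 := by nlinarith
  have hU : 2 * τ * (H * (4 * (1 + Real.log ((N ^ 38 : ℕ) : ℝ)))) ≤ 1 := by
    have := mul_le_mul_of_nonneg_left hHl (by positivity : 0 ≤ 8 * τ)
    nlinarith
  set ω : ℕ → ℕ := fun n => s (M + (n + 1)) - 1 with hω
  have hsω : ∀ n, ω n + 1 = s (M + (n + 1)) := by
    intro n
    have := hs1 (M + (n+1)) (by omega)
    simp only [hω]; omega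
  have hωm : StrictMono ω := by
    intro a b hab
    have h1 := hs (show M + (a + 1) < M + (b + 1) by omega)
    have h2 := hsω a
    have h3 := hsω b
    omega
  have hm := main_est (θ := θ) hcoef ξ A B hξ hA hAB ω hωm H hH1 hHN τ hτ hτ1 hU hE3 hE4
  have e : ∀ x : ℝ, ∑ n ∈ Finset.Icc 1 N, fourierPartial f (N ^ 38) (ξ * x ^ s (M + n)) =
      ∑ n ∈ Finset.range N, gg r θ (N ^ 38) (ξ * x ^ (ω n + 1)) := by
    intro x
    rw [sum_Icc_shift]
    refine Finset.sum_congr rfl fun n _ => ?_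
    rw [hsω, hrep]; rfl
  simp only [e]
  exact hm
end

section
/- There exists a constant C, depending only on ξ, A, B, such that the following holds. Let f satisfy condition (f), let M ≥ 0 and N ≥ 1, write w_n = s_{M+n} for 1 ≤ n ≤ N, let g be the N^{38}-th partial sum of the Fourier series of f, and let r = f − g. Then ∫_A^B ( Σ_{n=1}^N r(ξ x^{w_n}) )² dx ≤ C N^{-15}. -/
open MeasureTheory Filter

lemma f_decomp (f : ℝ → ℝ) (hv : eVariationOn f (Set.Icc (0:ℝ) 1) ≤ 2) :
    ∃ v : ℝ → ℝ, MonotoneOn v (Set.Icc 0 1) ∧ MonotoneOn (v - f) (Set.Icc 0 1) ∧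
      v 1 - v 0 ≤ 2 ∧
      ∀ x ∈ Set.Icc (0:ℝ) 1, ∀ y ∈ Set.Icc (0:ℝ) 1, x ≤ y → |f y - f x| ≤ v y - v x := by
  have hbv : BoundedVariationOn f (Set.Icc (0:ℝ) 1) := ne_top_of_le_ne_top (by simp) hv
  have hl := hbv.locallyBoundedVariationOn
  have h0 : (0:ℝ) ∈ Set.Icc (0:ℝ) 1 := by simp
  refine ⟨variationOnFromTo f (Set.Icc 0 1) 0, variationOnFromTo.monotoneOn hl h0,
    variationOnFromTo.sub_self_monotoneOn hl h0, ?_, ?_⟩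
  · rw [variationOnFromTo.self, variationOnFromTo.eq_of_le _ _ zero_le_one, sub_zero, Set.inter_self]
    exact ENNReal.toReal_le_of_le_ofReal (by norm_num) (by simpa using hv)
  · intro x hx y hy hxy
    have := variationOnFromTo.add hl h0 hx hy
    rw [← this, add_sub_cancel_left]
    rw [variationOnFromTo.eq_of_le _ _ hxy]
    rw [← Real.dist_eq, dist_edist]
    apply ENNReal.toReal_mono
    · exact hl x y hx hy
    · apply eVariationOn.edist_le f <;> simp [hx.1, hx.2, hy.1, hy.2, hxy]

lemma f_bdd (f : ℝ → ℝ) (hper : ∀ x : ℝ, f (x + 1) = f x)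
    (hv : eVariationOn f (Set.Icc (0:ℝ) 1) ≤ 2) : ∃ C, ∀ x, |f x| ≤ C := by
  obtain ⟨v, h1, h2, h3, h4⟩ := f_decomp f hv
  refine ⟨|f 0| + 2, fun x => ?_⟩
  have hp : Function.Periodic f 1 := hper
  have : f x = f (Int.fract x) := by
    have := hp.sub_int_mul_eq (x := x) ⌊x⌋
    rw [mul_one] at this; exact this.symm
  rw [this]
  have hx : Int.fract x ∈ Set.Icc (0:ℝ) 1 := ⟨Int.fract_nonneg x, (Int.fract_lt_one x).le⟩
  have h5 := h4 0 (by simp) _ hx hx.1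
  have h6 := h1 hx (by simp) hx.2
  have := abs_sub_abs_le_abs_sub (f (Int.fract x)) (f 0)
  linarith

lemma f_meas (f : ℝ → ℝ) (hper : ∀ x : ℝ, f (x + 1) = f x)
    (hv : eVariationOn f (Set.Icc (0:ℝ) 1) ≤ 2) : Measurable f := by
  obtain ⟨v, h1, h2, h3, h4⟩ := f_decomp f hv
  have hp : Function.Periodic f 1 := hper
  have key : ∀ u : ℝ → ℝ, MonotoneOn u (Set.Icc 0 1) → Measurable (fun x => u (max 0 (min 1 x))) := by
    intro u hu
    apply Monotone.measurable
    intro x y hxy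
    apply hu
    · simp
    · simp
    · gcongr
  have m := ((key _ h1).sub (key _ h2)).comp measurable_fract
  convert m using 1
  ext x
  have hx : Int.fract x ∈ Set.Icc (0:ℝ) 1 := ⟨Int.fract_nonneg x, (Int.fract_lt_one x).le⟩
  have : f x = f (Int.fract x) := by
    have := hp.sub_int_mul_eq (x := x) ⌊x⌋
    rw [mul_one] at this; exact this.symm
  simp [min_eq_right hx.2, max_eq_right hx.1, this]

lemma cov (h : ℝ → ℝ) (hm : Measurable h) (hb : ∃ C, ∀ x, |h x| ≤ C) (h0 : ∀ x, 0 ≤ h x)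
    (hper : Function.Periodic h 1) (ξ A : ℝ) (hξ : 0 < ξ) (hA : 1 < A) (w : ℕ) (hw : 1 ≤ w) :
    ∫ x in A..(A+1), h (ξ * x ^ w) ≤ (1 + 1 / ξ) * ∫ x in (0:ℝ)..1, h x := by
  obtain ⟨D, hD⟩ := hb
  set K := ∫ x in (0:ℝ)..1, h x with hK
  have hK0 : 0 ≤ K := intervalIntegral.integral_nonneg zero_le_one (fun x _ => h0 x)
  have hA0 : 0 < A := by linarith
  have hw0 : w ≠ 0 := by omega
  let P : ℝ → ℝ := fun x => ξ * w * x ^ (w-1)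
  have hPmono : ∀ x y, 0 ≤ x → x ≤ y → P x ≤ P y := by
    intro x y hx hxy; simp only [P]; gcongr
  have hPA : ξ ≤ P A := by
    simp only [P]
    have : (1:ℝ) ≤ w := by exact_mod_cast hw
    have h2 : (1:ℝ) ≤ A ^ (w-1) := one_le_pow₀ hA.le
    have : (1:ℝ) ≤ w * A ^ (w-1) := one_le_mul_of_one_le_of_one_le this h2
    nlinarith
  have hder : ∀ x, HasDerivAt (fun x : ℝ => ξ * x ^ w) (P x) x := by
    intro x
    have := (hasDerivAt_pow w x).const_mul ξ
    simpa [P, mul_assoc] using this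
  have hI : ∀ a b, IntervalIntegrable (fun x => h (ξ * x ^ w)) volume a b := by
    intro a b
    refine (intervalIntegrable_const (c := D)).mono_fun ?_ ?_
    · exact (hm.comp (by fun_prop)).aestronglyMeasurable
    · filter_upwards with x
      simpa using (hD _).trans (le_abs_self _)
  -- the nodes
  have hx : ∀ k : ℕ, ∃ x, 0 ≤ x ∧ ξ * x ^ w = ξ * A ^ w + k := by
    intro k
    refine ⟨(A ^ w + k / ξ) ^ ((w:ℝ)⁻¹), by positivity, ?_⟩
    rw [Real.rpow_inv_natCast_pow (by positivity) hw0]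
    field_simp
  choose x hx0 hx using hx
  have hlt : ∀ a b, 0 ≤ a → 0 ≤ b → ξ * a ^ w ≤ ξ * b ^ w → a ≤ b := by
    intro a b ha hb h
    exact le_of_pow_le_pow_left₀ hw0 hb (le_of_mul_le_mul_left h hξ)
  have hx00 : x 0 = A := by
    apply le_antisymm <;> apply hlt <;> simp [hx, hx0, hA0.le]
  have hxs : ∀ k, x k ≤ x (k+1) := by
    intro k; apply hlt _ _ (hx0 _) (hx0 _); simp [hx]
  have hxm : Monotone x := monotone_nat_of_le_succ hxs
  have hxA : ∀ k, A ≤ x k := fun k => hx00 ▸ hxm (Nat.zero_le k)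
  have hPpos : ∀ k, 0 < P (x k) := fun k =>
    hξ.trans_le (hPA.trans (hPmono _ _ hA0.le (hxA k)))
  have hpiece : ∀ k, ∫ t in (x k)..(x (k+1)), h (ξ * t ^ w) ≤ K / P (x k) := by
    intro k
    rw [le_div_iff₀ (hPpos k), ← intervalIntegral.integral_mul_const]
    have himg : (fun t : ℝ => ξ * t ^ w) '' Set.Icc (x k) (x (k+1)) =
        Set.Icc (ξ * A ^ w + k) (ξ * A ^ w + k + 1) := by
      apply Set.Subset.antisymm
      · rintro _ ⟨t, ht, rfl⟩
        have ht0 := (hx0 k).trans ht.1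
        constructor
        · rw [← hx]; have := ht.1; have := hx0 k; dsimp only; gcongr
        · have := hx (k+1); push_cast at this; rw [add_assoc, ← this]
          have := ht.2; dsimp only; gcongr
      · have := intermediate_value_Icc (hxs k) (f := fun t : ℝ => ξ * t ^ w) (by fun_prop)
        simp only [hx] at this
        push_cast at this
        rwa [add_assoc]
    have hinj : Set.InjOn (fun t : ℝ => ξ * t ^ w) (Set.Icc (x k) (x (k+1))) := by
      intro a ha b hb hab
      have ha0 := (hx0 k).trans ha.1
      have hb0 := (hx0 k).trans hb.1
      exact le_antisymm (hlt _ _ ha0 hb0 hab.le) (hlt _ _ hb0 ha0 hab.ge)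
    have hc := integral_image_eq_integral_abs_deriv_smul (measurableSet_Icc)
      (fun t _ => (hder t).hasDerivWithinAt) hinj h
    rw [himg, integral_Icc_eq_integral_Ioc, ← intervalIntegral.integral_of_le (by linarith),
      hper.intervalIntegral_add_eq _ 0, zero_add, ← hK, integral_Icc_eq_integral_Ioc,
      ← intervalIntegral.integral_of_le (hxs k)] at hc
    rw [hc]
    apply intervalIntegral.integral_mono_on (hxs k)
    · exact (hI _ _).mul_const _
    · apply IntervalIntegrable.continuousOn_smul (hI _ _)
      simp only [P]
      fun_prop
    · intro t ht
      have := hPmono _ _ (hx0 k) ht.1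
      rw [abs_of_pos ((hPpos k).trans_le this), smul_eq_mul, mul_comm]
      exact mul_le_mul_of_nonneg_right this (h0 _)
  have hgap : ∀ k, 1 / P (x (k+1)) ≤ x (k+1) - x k := by
    intro k
    rw [div_le_iff₀ (hPpos _)]
    have h1 : ξ * x (k+1) ^ w - ξ * x k ^ w = 1 := by rw [hx, hx]; push_cast; ring
    have h2 := Convex.norm_image_sub_le_of_norm_hasDerivWithin_le (f := fun t : ℝ => ξ * t ^ w)
      (f' := P) (C := P (x (k+1))) (s := Set.Icc (x k) (x (k+1))) (x := x k) (y := x (k+1))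
      (fun t _ => (hder t).hasDerivWithinAt) ?_ (convex_Icc _ _) ?_ ?_
    · rw [h1, Real.norm_of_nonneg (sub_nonneg.2 (hxs k))] at h2
      simp at h2
      linarith
    · intro t ht
      have ht0 := (hx0 k).trans ht.1
      rw [Real.norm_of_nonneg (by simp only [P]; positivity)]
      exact hPmono _ _ ht0 ht.2
    · simp [hxs]
    · simp [hxs]
  have hsum : ∀ k, ∫ t in A..(x (k+1)), h (ξ * t ^ w) ≤ K * (1 / ξ + (x k - A)) := by
    intro k
    induction k with
    | zero =>
      have := hpiece 0
      rw [hx00] at this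
      rw [hx00]
      refine this.trans ?_
      rw [sub_self, add_zero, div_eq_mul_one_div]
      gcongr
    | succ k ih =>
      rw [← intervalIntegral.integral_add_adjacent_intervals (hI A (x (k+1))) (hI _ _)]
      have h1 := hpiece (k+1)
      have h2 := mul_le_mul_of_nonneg_left (hgap k) hK0
      rw [← div_eq_mul_one_div] at h2
      linarith
  -- choose k minimal with A+1 ≤ x (k+1)
  have hex : ∃ k, A + 1 ≤ x k := by
    obtain ⟨k, hk⟩ := exists_nat_ge (ξ * (A+1)^w)
    refine ⟨k, hlt _ _ (by linarith) (hx0 k) ?_⟩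
    rw [hx]
    have : 0 ≤ ξ * A ^ w := by positivity
    linarith
  classical
  obtain ⟨k, hk1, hk2⟩ : ∃ k, x k ≤ A + 1 ∧ A + 1 ≤ x (k+1) := by
    have hs := Nat.find_spec hex
    have hmin := fun m => @Nat.find_min _ _ hex m
    cases hn : Nat.find hex with
    | zero => rw [hn, hx00] at hs; linarith
    | succ k =>
      rw [hn] at hs
      exact ⟨k, (not_le.1 (hmin k (by omega))).le, hs⟩
  calc ∫ t in A..(A+1), h (ξ * t ^ w) ≤ ∫ t in A..(x (k+1)), h (ξ * t ^ w) := by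
        apply intervalIntegral.integral_mono_interval le_rfl (by linarith) hk2
        · filter_upwards with t using h0 _
        · exact hI _ _
    _ ≤ K * (1 / ξ + (x k - A)) := hsum k
    _ ≤ (1 + 1 / ξ) * K := by
        rw [mul_comm]; apply mul_le_mul_of_nonneg_right _ hK0; linarith

noncomputable def eE (n : ℤ) (x : ℝ) : ℂ := Complex.exp (2 * Real.pi * Complex.I * n * x)

noncomputable def cF (F : ℝ → ℂ) (n : ℤ) : ℂ := ∫ x in (0:ℝ)..1, eE (-n) x * F x

lemma eE_cont (n : ℤ) : Continuous (eE n) := by unfold eE; fun_prop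

lemma eE_norm (n : ℤ) (x : ℝ) : ‖eE n x‖ = 1 := by
  have : 2 * Real.pi * Complex.I * n * x = ((2 * Real.pi * n * x : ℝ) : ℂ) * Complex.I := by
    push_cast; ring
  rw [eE, this, Complex.norm_exp_ofReal_mul_I]

lemma eE_add (m n : ℤ) (x : ℝ) : eE m x * eE n x = eE (m + n) x := by
  rw [eE, eE, eE, ← Complex.exp_add]; push_cast; ring_nf

lemma eE_int (n : ℤ) (hn : n ≠ 0) (a b : ℝ) (k : ℤ) (hb : (n:ℝ) * b = n * a + k) :
    ∫ x in a..b, eE n x = 0 := by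
  have hc : (2 * Real.pi * Complex.I * n : ℂ) ≠ 0 := by
    simp [hn, Real.pi_ne_zero]
  simp only [eE]
  rw [integral_exp_mul_complex hc]
  have hb' : (n:ℂ) * b = n * a + k := by exact_mod_cast hb
  have : (2 * Real.pi * Complex.I * n : ℂ) * b =
      2 * Real.pi * Complex.I * n * a + k * (2 * Real.pi * Complex.I) := by
    rw [mul_assoc, hb']; ring
  rw [this, Complex.exp_add, Complex.exp_int_mul_two_pi_mul_I]
  simp

lemma eE_orth (n : ℤ) : ∫ x in (0:ℝ)..1, eE n x = if n = 0 then 1 else 0 := by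
  split_ifs with h
  · simp [h, eE]
  · exact eE_int n h 0 1 n (by simp)

lemma cF_eE (m n : ℤ) : cF (eE m) n = if n = m then 1 else 0 := by
  simp only [cF, eE_add, eE_orth]
  congr 1
  simp only [eq_iff_iff]
  constructor <;> intro h <;> omega

lemma parseval (F : ℝ → ℂ) (hm : Measurable F) (hb : ∃ C, ∀ x, ‖F x‖ ≤ C) :
    HasSum (fun n => ‖cF F n‖ ^ 2) (∫ x in (0:ℝ)..1, ‖F x‖ ^ 2) := by
  obtain ⟨C, hC⟩ := hb
  have h2 : MemLp F 2 (volume.restrict (Set.Ioc 0 1)) :=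
    MemLp.of_bound hm.aestronglyMeasurable C (by filter_upwards with x using hC x)
  have := hasSum_sq_fourierCoeffOn zero_lt_one h2
  simp only [fourierCoeffOn_eq_integral, fourier_coe_apply] at this
  simpa [cF, eE] using this

lemma ii_of_bdd (F : ℝ → ℂ) (hm : Measurable F) (hb : ∃ C, ∀ x, ‖F x‖ ≤ C) (a b : ℝ) :
    IntervalIntegrable F volume a b := by
  obtain ⟨C, hC⟩ := hb
  refine (intervalIntegrable_const (c := C)).mono_fun hm.aestronglyMeasurable ?_
  filter_upwards with x
  simpa using (hC _).trans (le_abs_self _)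

lemma ii_mul (F : ℝ → ℂ) (hF : ∀ a b, IntervalIntegrable F volume a b) (n : ℤ) (a b : ℝ) :
    IntervalIntegrable (fun x => eE n x * F x) volume a b :=
  (hF a b).continuousOn_mul (eE_cont n).continuousOn

lemma coeff_bound (f : ℝ → ℝ) (hper : ∀ x : ℝ, f (x + 1) = f x)
    (hv : eVariationOn f (Set.Icc (0:ℝ) 1) ≤ 2) (n : ℤ) (hn : n ≠ 0) :
    ‖cF (fun x => (f x : ℂ)) n‖ ≤ 2 / |(n:ℝ)| := by
  have hI : ∀ a b, IntervalIntegrable (fun x => (f x : ℂ)) volume a b := by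
    apply ii_of_bdd
    · exact Complex.measurable_ofReal.comp (f_meas f hper hv)
    · simpa using f_bdd f hper hv
  obtain ⟨v, h1, h2, h3, h4⟩ := f_decomp f hv
  obtain ⟨m, hm⟩ : ∃ m : ℕ, m = n.natAbs := ⟨_, rfl⟩
  have hm0 : 0 < m := by omega
  have hmR : (0:ℝ) < m := by exact_mod_cast hm0
  have hmn : |(n:ℝ)| = m := by rw [hm, Nat.cast_natAbs]; simp
  rw [hmn]
  let a : ℕ → ℝ := fun k => k / m
  have ha : ∀ k, k ≤ m → a k ∈ Set.Icc (0:ℝ) 1 := by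
    intro k hk
    refine ⟨by positivity, ?_⟩
    simp only [a]
    rw [div_le_one hmR]; exact_mod_cast hk
  have hstep : ∀ k, a (k+1) = a k + 1 / m := by
    intro k; simp only [a]; push_cast; ring
  have h := intervalIntegral.sum_integral_adjacent_intervals (a := a) (n := m)
    (fun k _ => ii_mul _ hI (-n) (a k) (a (k+1)))
  have ha0 : a 0 = 0 := by simp [a]
  have ham : a m = 1 := by simp [a, hmR.ne']
  rw [ha0, ham] at h
  rw [cF, ← h]
  calc _ ≤ ∑ k ∈ Finset.range m, (v (a (k+1)) - v (a k)) * (1 / m) := by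
        refine (norm_sum_le _ _).trans (Finset.sum_le_sum fun k hk => ?_)
        have hk := Finset.mem_range.1 hk
        have hle : a k ≤ a (k+1) := by rw [hstep]; simp
        have hz : ∫ x in (a k)..(a (k+1)), eE (-n) x = 0 := by
          have hs : ∃ e : ℤ, (-n) = e * m := by
            rcases Int.natAbs_eq n with hh | hh
            · exact ⟨-1, by rw [← hm] at hh; rw [hh]; ring⟩
            · exact ⟨1, by rw [← hm] at hh; rw [hh]; ring⟩
          obtain ⟨e, he⟩ := hs
          refine eE_int (-n) (by simpa using hn) _ _ e ?_
          rw [hstep, he]; push_cast; field_simp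
        have : ∫ x in (a k)..(a (k+1)), eE (-n) x * (f x : ℂ) =
            ∫ x in (a k)..(a (k+1)), eE (-n) x * ((f x - f (a k) : ℝ) : ℂ) := by
          rw [← sub_zero (∫ x in (a k)..(a (k+1)), eE (-n) x * (f x : ℂ)),
            ← zero_mul (f (a k) : ℂ), ← hz, ← intervalIntegral.integral_mul_const,
            ← intervalIntegral.integral_sub (ii_mul _ hI _ _ _)]
          · congr 1; ext x; push_cast; ring
          · exact ((eE_cont _).mul continuous_const).intervalIntegrable _ _
        rw [this]
        have := intervalIntegral.norm_integral_le_of_norm_le_const (a := a k) (b := a (k+1))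
          (f := fun x => eE (-n) x * ((f x - f (a k) : ℝ) : ℂ)) (C := v (a (k+1)) - v (a k)) ?_
        · rwa [hstep, add_sub_cancel_left, abs_of_pos (by positivity), ← hstep] at this
        · intro x hx
          rw [Set.uIoc_of_le hle] at hx
          have hA := ha k hk.le
          have hB := ha (k+1) hk
          have hx' : x ∈ Set.Icc (0:ℝ) 1 := ⟨hA.1.trans hx.1.le, hx.2.trans hB.2⟩
          rw [norm_mul, eE_norm, one_mul, Complex.norm_real, Real.norm_eq_abs]
          have := h4 _ hA _ hx' hx.1.le
          have := h1 hx' hB hx.2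
          linarith
    _ = (v 1 - v 0) * (1 / m) := by
        rw [← Finset.sum_mul, Finset.sum_range_sub (fun k => v (a k)), ha0, ham]
    _ ≤ 2 / m := by
        rw [div_eq_mul_one_div 2]; gcongr

lemma partial_eq (f : ℝ → ℝ) (hf : ∀ a b, IntervalIntegrable (fun x => (f x : ℂ)) volume a b)
    (d : ℕ) (x : ℝ) : (fourierPartial f d x : ℂ) =
      ∑ j ∈ Finset.Icc 1 d, (cF (fun x => (f x : ℂ)) j * eE j x +
        cF (fun x => (f x : ℂ)) (-j) * eE (-j) x) := by
  rw [fourierPartial]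
  push_cast
  refine Finset.sum_congr rfl fun j _ => ?_
  have hE : ∀ (n : ℤ) (x : ℝ), eE n x = Complex.cos (2 * Real.pi * n * x) +
      Complex.sin (2 * Real.pi * n * x) * Complex.I := by
    intro n x
    rw [← Complex.exp_mul_I, eE]; ring_nf
  have hcos : ∀ x : ℝ, Complex.cos (2 * Real.pi * j * x) = (eE j x + eE (-j) x) / 2 := by
    intro x; rw [hE, hE]; push_cast
    simp only [mul_neg, neg_mul, Complex.cos_neg, Complex.sin_neg]; ring
  have hsin : ∀ x : ℝ, Complex.sin (2 * Real.pi * j * x) =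
      (eE (-j) x - eE j x) * Complex.I / 2 := by
    intro x; rw [hE, hE]; push_cast
    simp only [mul_neg, neg_mul, Complex.cos_neg, Complex.sin_neg]
    linear_combination (Complex.sin (2 * Real.pi * j * x)) * Complex.I_sq
  have hA : (fourierA f j : ℂ) = cF (fun x => (f x : ℂ)) j + cF (fun x => (f x : ℂ)) (-j) := by
    rw [fourierA, cF, cF, ← intervalIntegral.integral_add (ii_mul _ hf _ _ _) (ii_mul _ hf _ _ _)]
    push_cast
    rw [← intervalIntegral.integral_ofReal, ← intervalIntegral.integral_const_mul]
    congr 1; ext x; push_cast; rw [hcos, neg_neg]; ring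
  have hB : (fourierB f j : ℂ) =
      (cF (fun x => (f x : ℂ)) j - cF (fun x => (f x : ℂ)) (-j)) * Complex.I := by
    rw [fourierB, cF, cF, ← intervalIntegral.integral_sub (ii_mul _ hf _ _ _) (ii_mul _ hf _ _ _),
      ← intervalIntegral.integral_mul_const]
    push_cast
    rw [← intervalIntegral.integral_ofReal, ← intervalIntegral.integral_const_mul]
    congr 1; ext x; push_cast; rw [hsin, neg_neg]; ring
  rw [hA, hB, hcos, hsin]
  linear_combination ((cF (fun x => (f x : ℂ)) j - cF (fun x => (f x : ℂ)) (-j)) *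
    (eE (-j) x - eE j x) / 2) * Complex.I_sq

lemma partial_cont (f : ℝ → ℝ) (d : ℕ) : Continuous (fourierPartial f d) := by
  unfold fourierPartial; fun_prop

lemma partial_per (f : ℝ → ℝ) (d : ℕ) (x : ℝ) :
    fourierPartial f d (x + 1) = fourierPartial f d x := by
  unfold fourierPartial
  refine Finset.sum_congr rfl fun j _ => ?_
  have : 2 * Real.pi * j * (x + 1) = 2 * Real.pi * j * x + j * (2 * Real.pi) := by ring
  rw [this, Real.cos_add_nat_mul_two_pi, Real.sin_add_nat_mul_two_pi]

lemma partial_bdd (f : ℝ → ℝ) (d : ℕ) : ∃ C, ∀ x, |fourierPartial f d x| ≤ C := by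
  refine ⟨∑ j ∈ Finset.Icc 1 d, (|fourierA f j| + |fourierB f j|), fun x => ?_⟩
  unfold fourierPartial
  refine (Finset.abs_sum_le_sum_abs _ _).trans (Finset.sum_le_sum fun j _ => ?_)
  refine (abs_add_le _ _).trans ?_
  rw [abs_mul, abs_mul]
  gcongr
  · exact mul_le_of_le_one_right (abs_nonneg _) (Real.abs_cos_le_one _)
  · exact mul_le_of_le_one_right (abs_nonneg _) (Real.abs_sin_le_one _)

lemma cF_partial (f : ℝ → ℝ) (hf : ∀ a b, IntervalIntegrable (fun x => (f x : ℂ)) volume a b)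
    (d : ℕ) (n : ℤ) : cF (fun x => (fourierPartial f d x : ℂ)) n =
      if n ≠ 0 ∧ n.natAbs ≤ d then cF (fun x => (f x : ℂ)) n else 0 := by
  have h1 : cF (fun x => (fourierPartial f d x : ℂ)) n =
      ∑ j ∈ Finset.Icc 1 d, (cF (fun x => (f x : ℂ)) j * cF (eE j) n +
        cF (fun x => (f x : ℂ)) (-j) * cF (eE (-j)) n) := by
    simp only [partial_eq f hf]
    conv_lhs => rw [cF]
    simp only [Finset.mul_sum]
    rw [intervalIntegral.integral_finsetSum]
    · refine Finset.sum_congr rfl fun j _ => ?_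
      rw [cF.eq_def (eE j), cF.eq_def (eE (-j)), ← intervalIntegral.integral_const_mul,
        ← intervalIntegral.integral_const_mul, ← intervalIntegral.integral_add]
      · congr 1; ext x; ring
      · exact (continuous_const.mul ((eE_cont _).mul (eE_cont _))).intervalIntegrable _ _
      · exact (continuous_const.mul ((eE_cont _).mul (eE_cont _))).intervalIntegrable _ _
    · intro j _
      exact ((eE_cont _).mul ((continuous_const.mul (eE_cont _)).add
        (continuous_const.mul (eE_cont _)))).intervalIntegrable _ _
  rw [h1]
  simp only [cF_eE]
  split_ifs with h
  · rw [Finset.sum_eq_single n.natAbs]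
    · rcases Int.natAbs_eq n with hh | hh
      · rw [if_pos hh, if_neg (by omega), ← hh]; simp
      · rw [if_neg (by omega), if_pos hh, ← hh]; simp
    · intro j hj hjn
      have := Finset.mem_Icc.1 hj
      rw [if_neg (by omega), if_neg (by omega)]; simp
    · intro hh
      exfalso; apply hh; rw [Finset.mem_Icc]; omega
  · apply Finset.sum_eq_zero
    intro j hj
    have := Finset.mem_Icc.1 hj
    rw [if_neg (by omega), if_neg (by omega)]; simp

lemma tail_bound (f : ℝ → ℝ) (hper : ∀ x : ℝ, f (x + 1) = f x)
    (h0 : (∫ x in (0:ℝ)..1, f x) = 0)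
    (hv : eVariationOn f (Set.Icc (0:ℝ) 1) ≤ 2) (N : ℕ) (hN : 1 ≤ N) :
    ∫ x in (0:ℝ)..1, (f x - fourierPartial f (N ^ 38) x) ^ 2 ≤
      (4 * ∑' n : ℤ, |(n:ℝ)| ^ (-(3/2:ℝ))) / (N:ℝ) ^ 19 := by
  have hfm := f_meas f hper hv
  have hI : ∀ a b, IntervalIntegrable (fun x => (f x : ℂ)) volume a b := by
    apply ii_of_bdd
    · exact Complex.measurable_ofReal.comp hfm
    · simpa using f_bdd f hper hv
  have hNR : (1:ℝ) ≤ N := by exact_mod_cast hN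
  have hP := parseval (fun x => ((f x - fourierPartial f (N ^ 38) x : ℝ) : ℂ))
    (Complex.measurable_ofReal.comp (hfm.sub (partial_cont f _).measurable)) (by
      obtain ⟨C, hC⟩ := f_bdd f hper hv
      obtain ⟨D, hD⟩ := partial_bdd f (N ^ 38)
      refine ⟨C + D, fun x => ?_⟩
      rw [Complex.norm_real, Real.norm_eq_abs]
      exact (abs_sub _ _).trans (add_le_add (hC x) (hD x)))
  simp only [Complex.norm_real, Real.norm_eq_abs, sq_abs] at hP
  rw [← hP.tsum_eq, mul_div_right_comm, ← tsum_mul_left]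
  refine hP.summable.tsum_le_tsum (fun n => ?_)
    ((Real.summable_abs_int_rpow (by norm_num)).mul_left _)
  have hc : cF (fun x => ((f x - fourierPartial f (N ^ 38) x : ℝ) : ℂ)) n =
      cF (fun x => (f x : ℂ)) n - cF (fun x => (fourierPartial f (N ^ 38) x : ℂ)) n := by
    rw [cF, cF, cF, ← intervalIntegral.integral_sub (ii_mul _ hI _ _ _)]
    · congr 1; ext x; push_cast; ring
    · exact ((eE_cont _).mul (Complex.continuous_ofReal.comp
        (partial_cont f _))).intervalIntegrable _ _
  rw [hc, cF_partial f hI]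
  have hpos : 0 ≤ 4 / (N:ℝ) ^ 19 * |(n:ℝ)| ^ (-(3/2:ℝ)) := by positivity
  by_cases hn : n = 0
  · subst hn
    have : cF (fun x => (f x : ℂ)) 0 = 0 := by
      simp only [cF, eE]
      simp [intervalIntegral.integral_ofReal, h0]
    simp [this]
  by_cases hd : n.natAbs ≤ N ^ 38
  · rw [if_pos ⟨hn, hd⟩]; simpa using hpos
  rw [if_neg (by tauto), sub_zero]
  have hb := coeff_bound f hper hv n hn
  have hn0 : 0 < |(n:ℝ)| := by simpa using hn
  have hnN : (N:ℝ) ^ 38 ≤ |(n:ℝ)| := by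
    have : |(n:ℝ)| = (n.natAbs : ℝ) := by rw [Nat.cast_natAbs]; simp
    rw [this]; exact_mod_cast (by omega : N ^ 38 ≤ n.natAbs)
  have hsq : (N:ℝ) ^ 19 ≤ |(n:ℝ)| ^ (1/2:ℝ) := by
    rw [← Real.sqrt_eq_rpow]
    apply Real.le_sqrt_of_sq_le
    rw [← pow_mul]; exact hnN
  calc ‖cF (fun x => (f x : ℂ)) n‖ ^ 2 ≤ (2 / |(n:ℝ)|) ^ 2 := by gcongr
    _ = 4 / |(n:ℝ)| ^ (1/2:ℝ) * |(n:ℝ)| ^ (-(3/2:ℝ)) := by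
      rw [div_mul_eq_mul_div, mul_div_assoc, ← Real.rpow_sub hn0, div_pow, div_eq_mul_inv,
        ← Real.rpow_natCast |(n:ℝ)|, ← Real.rpow_neg hn0.le]
      norm_num
    _ ≤ _ := by gcongr

theorem stmt8 (ξ A B : ℝ) (hξ : 0 < ξ) (hA : 1 < A) (hAB : B - A = 1) :
    ∃ C : ℝ, 0 < C ∧
      ∀ s : ℕ → ℕ, StrictMono s → (∀ n, 1 ≤ n → 1 ≤ s n) →
      ∀ f : ℝ → ℝ, (∀ x : ℝ, f (x + 1) = f x) → (∫ x in (0:ℝ)..1, f x) = 0 →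
        eVariationOn f (Set.Icc (0:ℝ) 1) ≤ 2 →
      ∀ M N : ℕ, 1 ≤ N →
        (∫ x in A..B,
            (∑ n ∈ Finset.Icc 1 N,
              (f (ξ * x ^ s (M + n)) -
               fourierPartial f (N ^ 38) (ξ * x ^ s (M + n)))) ^ 2) ≤
          C * (N : ℝ) ^ (-15 : ℤ) := by
  obtain ⟨Z, hZ⟩ : ∃ Z, Z = ∑' n : ℤ, |(n:ℝ)| ^ (-(3/2:ℝ)) := ⟨_, rfl⟩
  have hZ0 : 0 ≤ Z := hZ ▸ tsum_nonneg fun n => by positivity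
  have hB : B = A + 1 := by linarith
  subst hB
  refine ⟨(1 + 1 / ξ) * (4 * Z) + 1, by positivity, ?_⟩
  intro s hs hs1 f hper h0 hv M N hN
  have hNR : (1:ℝ) ≤ N := by exact_mod_cast hN
  obtain ⟨C, hC⟩ := f_bdd f hper hv
  obtain ⟨D, hD⟩ := partial_bdd f (N ^ 38)
  have ht := tail_bound f hper h0 hv N hN
  rw [← hZ] at ht
  have hrm : Measurable (fun x => f x - fourierPartial f (N ^ 38) x) :=
    (f_meas f hper hv).sub (partial_cont f _).measurable
  set r : ℝ → ℝ := fun x => f x - fourierPartial f (N ^ 38) x with hr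
  have hrb : ∀ x, |r x| ≤ C + D := fun x =>
    (abs_sub _ _).trans (add_le_add (hC x) (hD x))
  have hrb2 : ∀ x, |r x ^ 2| ≤ (C + D) ^ 2 := fun x => by
    rw [abs_pow]; gcongr; exact hrb x
  have hterm : ∀ n ∈ Finset.Icc 1 N, ∫ x in A..(A+1), (r (ξ * x ^ s (M + n))) ^ 2 ≤
      (1 + 1 / ξ) * (4 * Z / (N:ℝ) ^ 19) := by
    intro n hn
    have hn := Finset.mem_Icc.1 hn
    refine (cov (fun x => r x ^ 2) (hrm.pow_const 2) ⟨_, hrb2⟩ (fun x => sq_nonneg _) ?_ ξ A hξ hA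
      (s (M + n)) (hs1 _ (by omega))).trans ?_
    · intro x; simp only [hr, hper, partial_per]
    · gcongr
  have hm : ∀ n, Measurable (fun x : ℝ => r (ξ * x ^ s (M + n))) := fun n =>
    hrm.comp (by fun_prop)
  have hI : ∀ n, IntervalIntegrable (fun x => r (ξ * x ^ s (M + n)) ^ 2) volume A (A+1) := by
    intro n
    refine (intervalIntegrable_const (c := (C + D) ^ 2)).mono_fun
      ((hm n).pow_const 2).aestronglyMeasurable ?_
    filter_upwards with x
    simpa using hrb2 (ξ * x ^ s (M + n))
  have hcs : ∀ x : ℝ, (∑ n ∈ Finset.Icc 1 N, r (ξ * x ^ s (M + n))) ^ 2 ≤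
      N * ∑ n ∈ Finset.Icc 1 N, r (ξ * x ^ s (M + n)) ^ 2 := by
    intro x
    simpa using sq_sum_le_card_mul_sum_sq (s := Finset.Icc 1 N)
      (f := fun n => r (ξ * x ^ s (M + n)))
  have hsumI : IntervalIntegrable (fun x : ℝ => (N:ℝ) * ∑ n ∈ Finset.Icc 1 N,
      r (ξ * x ^ s (M + n)) ^ 2) volume A (A+1) := by
    apply IntervalIntegrable.const_mul
    have := IntervalIntegrable.sum (Finset.Icc 1 N) (fun n _ => hI n)
    rwa [Finset.sum_fn] at this
  calc _ ≤ ∫ x in A..(A+1), (N:ℝ) * ∑ n ∈ Finset.Icc 1 N, r (ξ * x ^ s (M + n)) ^ 2 := by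
        apply intervalIntegral.integral_mono_on (by linarith) _ hsumI (fun x _ => hcs x)
        refine hsumI.mono_fun
          ((Finset.measurable_sum _ fun n _ => hm n).pow_const 2).aestronglyMeasurable ?_
        filter_upwards with x
        rw [Real.norm_of_nonneg (sq_nonneg _)]
        exact (hcs x).trans (le_abs_self _)
    _ = N * ∑ n ∈ Finset.Icc 1 N, ∫ x in A..(A+1), r (ξ * x ^ s (M + n)) ^ 2 := by
        rw [intervalIntegral.integral_const_mul, intervalIntegral.integral_finsetSum]
        exact fun n _ => hI n
    _ ≤ N * ∑ n ∈ Finset.Icc 1 N, (1 + 1 / ξ) * (4 * Z / (N:ℝ) ^ 19) := by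
        gcongr with n hn; exact hterm n hn
    _ = ((1 + 1 / ξ) * (4 * Z)) * (1 / (N:ℝ) ^ 17) := by
        simp only [Finset.sum_const, Nat.card_Icc, add_tsub_cancel_right, nsmul_eq_mul]
        field_simp
    _ ≤ ((1 + 1 / ξ) * (4 * Z) + 1) * (1 / (N:ℝ) ^ 15) := by
        gcongr
        · linarith
        · norm_num
    _ = _ := by
        rw [zpow_neg, one_div ((N:ℝ) ^ 15)]; rfl
end
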